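/- arXiv:1707.04615 — 3 statements merged into one kernel-verified Lean document; each statement's English description precedes it below -/
import Mathlib

section
/- Let φ: ℝ → ℝ be periodic with period θ > 0, and let D be a logconcave probability distribution on ℝ with standard deviation σ > θ. Then ∫₀^θ |φ(x)| dx ≤ C·θ · E_{x∼D}[|φ(x)|] for some absolute constant C. -/
open MeasureTheory Set

/-- Multiplicative form of the log-concavity, as exponential decay. -/
lemma decay_aux (f : ℝ → ℝ) (hf0 : ∀ x, 0 ≤ f x)
    (hc : ConcaveOn ℝ {x | 0 < f x} (fun x => Real.log (f x)))
    (t : ℝ) (ht : 0 < t) (x0 y x w : ℝ) (hw : 0 < w) (hw1 : w ≤ 1)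
    (hy : y = (1 - w) * x0 + w * x) (hfy : f y < t) (hx0 : Real.exp (5/4) * t ≤ f x0) :
    f x ≤ t * Real.exp (-((5/4) * ((1 - w) / w))) := by
  rcases (hf0 x).eq_or_lt with h | h
  · rw [← h]; positivity
  have hx0p : 0 < f x0 := lt_of_lt_of_le (by positivity) hx0
  have hmx0 : x0 ∈ {x | 0 < f x} := hx0p
  have hmx : x ∈ {x | 0 < f x} := h
  have hw' : 0 ≤ 1 - w := by linarith
  have hsum : (1 - w) + w = 1 := by ring
  have h1 := hc.2 hmx0 hmx hw' hw.le hsum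
  have h2 : (1 - w) • x0 + w • x ∈ {x | 0 < f x} := hc.1 hmx0 hmx hw' hw.le hsum
  simp only [smul_eq_mul, ← hy, mem_ofPred_eq] at h1 h2
  have h3 : Real.log (f y) ≤ Real.log t := Real.log_le_log h2 hfy.le
  have h4 : 5/4 + Real.log t ≤ Real.log (f x0) := by
    have := Real.log_le_log (by positivity) hx0
    rwa [Real.log_mul (by positivity) ht.ne', Real.log_exp] at this
  rw [← Real.log_le_log_iff h (by positivity), Real.log_mul ht.ne' (by positivity), Real.log_exp]
  have h5 : (1 - w) * (5/4 + Real.log t) ≤ (1 - w) * Real.log (f x0) :=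
    mul_le_mul_of_nonneg_left h4 (by linarith)
  have h6 : w * Real.log (f x) ≤ w * (Real.log t + -((5/4) * ((1 - w) / w))) := by
    have : w * (Real.log t + -((5/4) * ((1 - w) / w))) = w * Real.log t - 5/4 * (1 - w) := by
      field_simp
      ring
    rw [this]; nlinarith
  exact le_of_mul_le_mul_left h6 hw

lemma ordConn_aux (f : ℝ → ℝ) 
    (hc : ConcaveOn ℝ {x | 0 < f x} (fun x => Real.log (f x)))
    (t : ℝ) (ht : 0 < t) : OrdConnected {x | t ≤ f x} := by
  have : Convex ℝ {x | t ≤ f x} := by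
    have h := hc.convex_ge (Real.log t)
    convert h using 1
    ext x
    simp only [mem_ofPred_eq]
    constructor
    · intro hx
      exact ⟨ht.trans_le hx, Real.log_le_log ht hx⟩
    · rintro ⟨h1, h2⟩
      exact (Real.log_le_log_iff ht h1).1 h2
  exact this.ordConnected

lemma meas_aux (f : ℝ → ℝ) (hf0 : ∀ x, 0 ≤ f x)
    (hc : ConcaveOn ℝ {x | 0 < f x} (fun x => Real.log (f x))) : Measurable f := by
  apply measurable_of_Ici
  intro t
  rcases le_or_gt t 0 with h | h
  · have : f ⁻¹' Ici t = univ := by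
      ext x; simp [h.trans (hf0 x)]
    rw [this]; exact MeasurableSet.univ
  · exact (ordConn_aux f hc t h).measurableSet

lemma dens_int (f g : ℝ → ℝ) (hf0 : ∀ x, 0 ≤ f x) (hm : Measurable f) :
    Integrable g (volume.withDensity (fun x => ENNReal.ofReal (f x))) ↔
      Integrable (fun x => f x * g x) := by
  rw [integrable_withDensity_iff_integrable_smul' hm.ennreal_ofReal (by simp)]
  simp [ENNReal.toReal_ofReal (hf0 _)]

lemma dens_eq (f g : ℝ → ℝ) (hf0 : ∀ x, 0 ≤ f x) (hm : Measurable f) :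
    ∫ x, g x ∂(volume.withDensity (fun x => ENNReal.ofReal (f x))) = ∫ x, f x * g x := by
  rw [integral_withDensity_eq_integral_toReal_smul hm.ennreal_ofReal (by simp)]
  simp [ENNReal.toReal_ofReal (hf0 _)]

/-- Some point has density at least `1/(8σ)`. -/
lemma peak_aux (f : ℝ → ℝ) (hf0 : ∀ x, 0 ≤ f x) (m σ : ℝ) (hσ : 0 < σ)
    (h1 : Integrable f) (h1' : ∫ x, f x = 1)
    (h2 : Integrable (fun x => f x * (x - m)^2)) (h2' : ∫ x, f x * (x - m)^2 = σ^2) :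
    ∃ x0, 1 / (8 * σ) ≤ f x0 := by
  by_contra! hcon
  have hi : Integrable (fun x => (Icc (m - 2*σ) (m + 2*σ)).indicator (fun _ => 1 / (8 * σ)) x
      + (1 / (4*σ^2)) * (f x * (x - m)^2)) := by
    refine Integrable.add ?_ (h2.const_mul _)
    exact (integrable_indicator_iff measurableSet_Icc).2 (integrableOn_const (by simp))
  have := integral_mono h1 hi (by
    intro x
    by_cases hx : x ∈ Icc (m - 2*σ) (m + 2*σ)
    · simp only [indicator_of_mem hx]
      have : 0 ≤ 1 / (4*σ^2) * (f x * (x - m)^2) := by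
        have := hf0 x; positivity
      linarith [hcon x]
    · simp only [indicator_of_notMem hx, zero_add]
      have h4 : 4 * σ^2 ≤ (x - m)^2 := by
        by_contra! h
        apply hx
        have := abs_lt_of_sq_lt_sq (a := x - m) (b := 2 * σ) (by nlinarith) (by linarith)
        rw [abs_lt] at this
        constructor <;> linarith
      have h5 : f x * (4 * σ^2) ≤ f x * (x - m)^2 := mul_le_mul_of_nonneg_left h4 (hf0 x)
      rw [one_div, inv_mul_eq_div, le_div_iff₀ (by positivity)]
      exact h5)
  rw [integral_add ((integrable_indicator_iff measurableSet_Icc).2 (integrableOn_const (by simp)))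
    (h2.const_mul _), integral_const_mul, h1', h2', integral_indicator measurableSet_Icc] at this
  simp only [integral_const, smul_eq_mul] at this
  rw [Measure.real, Measure.restrict_apply_univ, Real.volume_Icc,
    ENNReal.toReal_ofReal (by linarith)] at this
  have e : (m + 2 * σ - (m - 2 * σ)) * (1 / (8 * σ)) + 1 / (4 * σ ^ 2) * σ ^ 2 = 3/4 := by
    field_simp
    ring
  linarith

lemma exp_poly (u : ℝ) : u^2 * Real.exp (-|u|) ≤ 26 * (1 + u^2)⁻¹ := by
  have h2 := Real.pow_div_factorial_le_exp |u| (abs_nonneg u) 2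
  have h4 := Real.pow_div_factorial_le_exp |u| (abs_nonneg u) 4
  have e4 : |u|^4 = u^4 := by
    rw [show (4:ℕ) = 2*2 by norm_num, pow_mul, sq_abs, ← pow_mul]
  rw [sq_abs] at h2
  rw [e4] at h4
  norm_num [Nat.factorial] at h2 h4
  rw [Real.exp_neg, ← div_eq_mul_inv, ← div_eq_mul_inv, div_le_div_iff₀ (Real.exp_pos _) (by positivity)]
  nlinarith

lemma interval_aux (f : ℝ → ℝ) (hf0 : ∀ x, 0 ≤ f x) (m σ : ℝ) (hσ : 0 < σ)
    (hc : ConcaveOn ℝ {x | 0 < f x} (fun x => Real.log (f x)))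
    (h1 : Integrable f) (h1' : ∫ x, f x = 1)
    (h2 : Integrable (fun x => f x * (x - m)^2)) (h2' : ∫ x, f x * (x - m)^2 = σ^2)
    (h3 : Integrable (fun x => f x * x)) (h3' : ∫ x, f x * x = m) :
    ∃ a, ∀ x ∈ Icc a (a + σ), 1 / (1000 * σ) ≤ f x := by
  obtain ⟨x0, hx0⟩ := peak_aux f hf0 m σ hσ h1 h1' h2 h2'
  by_contra! hcon
  set t := 1 / (1000 * σ) with ht
  have htp : 0 < t := by positivity
  have hoc := ordConn_aux f hc t htp
  set S := {x | t ≤ f x} with hS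
  have hx0t : Real.exp (5/4) * t ≤ f x0 := by
    refine le_trans ?_ hx0
    have : Real.exp (5/4) ≤ 125 := by
      have h := Real.exp_one_lt_d9
      have : Real.exp (5/4) ≤ Real.exp 1 ^ 2 := by
        rw [← Real.exp_nat_mul]; apply Real.exp_le_exp.2; norm_num
      nlinarith [Real.exp_pos 1]
    calc Real.exp (5/4) * t ≤ 125 * t := by gcongr
      _ = 1 / (8 * σ) := by rw [ht]; field_simp; norm_num
  have hx0S : x0 ∈ S := by
    have : 1 ≤ Real.exp (5/4) := Real.one_le_exp (by norm_num)
    show t ≤ f x0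
    nlinarith
  have hdist : ∀ a ∈ S, ∀ b ∈ S, b < a + σ := by
    intro a ha b hb
    by_contra! h
    obtain ⟨x, hx, hlt⟩ := hcon a
    exact absurd (hoc.out ha hb ⟨hx.1, hx.2.trans h⟩) (not_le.2 hlt)
  have hba : BddAbove S := ⟨x0 + σ, fun b hb => (hdist x0 hx0S b hb).le⟩
  have hbb : BddBelow S := ⟨x0 - σ, fun b hb => by linarith [hdist b hb x0 hx0S]⟩
  set β := sSup S with hβ
  set α := sInf S with hα
  have hαβ : β - α ≤ σ := by
    have : ∀ a ∈ S, β ≤ a + σ := fun a ha => csSup_le ⟨x0, hx0S⟩ fun b hb => (hdist a ha b hb).le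
    have : β - σ ≤ α := le_csInf ⟨x0, hx0S⟩ fun a ha => by linarith [this a ha]
    linarith
  have hxβ : x0 ≤ β := le_csSup hba hx0S
  have hαx : α ≤ x0 := csInf_le hbb hx0S
  set c0 := (α + β) / 2 with hc0
  -- decay
  have hdec : ∀ x, 3/4 * σ ≤ |x - c0| → f x ≤ t * Real.exp (-((|x - c0| - 3/4 * σ) / σ)) := by
    intro x hx
    rcases le_total 0 (x - c0) with h | h
    · rw [abs_of_nonneg h] at hx ⊢
      have hy0 : f (β + σ/4) < t := by
        by_contra! h'
        linarith [le_csSup hba (show β + σ/4 ∈ S from h')]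
      have hpos : 0 < x - x0 := by linarith
      have hposy : 0 < β + σ/4 - x0 := by linarith
      refine (decay_aux f hf0 hc t htp x0 (β + σ/4) x ((β + σ/4 - x0) / (x - x0))
        (by positivity) ?_ ?_ hy0 hx0t).trans ?_
      · rw [div_le_one hpos]; linarith
      · field_simp; ring
      · gcongr
        have e : (1 - (β + σ/4 - x0) / (x - x0)) / ((β + σ/4 - x0) / (x - x0))
            = (x - (β + σ/4)) / (β + σ/4 - x0) := by
          field_simp; ring
        rw [e, ← mul_div_assoc, div_le_div_iff₀ hσ hposy]
        nlinarith
    · rw [abs_of_nonpos h] at hx ⊢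
      have hy0 : f (α - σ/4) < t := by
        by_contra! h'
        linarith [csInf_le hbb (show α - σ/4 ∈ S from h')]
      have hpos : 0 < x0 - x := by linarith
      have hposy : 0 < x0 - (α - σ/4) := by linarith
      refine (decay_aux f hf0 hc t htp x0 (α - σ/4) x ((x0 - (α - σ/4)) / (x0 - x))
        (by positivity) ?_ ?_ hy0 hx0t).trans ?_
      · rw [div_le_one hpos]; linarith
      · field_simp; ring
      · gcongr
        have e : (1 - (x0 - (α - σ/4)) / (x0 - x)) / ((x0 - (α - σ/4)) / (x0 - x))
            = ((α - σ/4) - x) / (x0 - (α - σ/4)) := by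
          field_simp; ring
        rw [e, ← mul_div_assoc, div_le_div_iff₀ hσ hposy]
        nlinarith
  -- pointwise bound
  have hpt : ∀ x, f x * (x - c0)^2 ≤
      9/16 * σ^2 * f x + (78 * t * σ^2) * (1 + (σ⁻¹ * x - σ⁻¹ * c0)^2)⁻¹ := by
    intro x
    have hfx := hf0 x
    rcases le_total |x - c0| (3/4 * σ) with h | h
    · have : (x - c0)^2 ≤ 9/16 * σ^2 := by
        rw [← sq_abs]; nlinarith [abs_nonneg (x - c0)]
      have h' := mul_le_mul_of_nonneg_left this hfx
      have : 0 ≤ (78 * t * σ^2) * (1 + (σ⁻¹ * x - σ⁻¹ * c0)^2)⁻¹ := by positivity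
      linarith
    · have hd := hdec x h
      have hp := exp_poly (σ⁻¹ * x - σ⁻¹ * c0)
      have eu : |σ⁻¹ * x - σ⁻¹ * c0| = |x - c0| / σ := by
        rw [← mul_sub, abs_mul, abs_of_pos (inv_pos.2 hσ)]; field_simp
      have eq2 : (x - c0)^2 = σ^2 * (σ⁻¹ * x - σ⁻¹ * c0)^2 := by field_simp
      have e3 : Real.exp (-((|x - c0| - 3/4 * σ) / σ)) ≤ 3 * Real.exp (-(|x - c0| / σ)) := by
        have : -((|x - c0| - 3/4 * σ) / σ) = 3/4 + -(|x - c0| / σ) := by field_simp; ring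
        rw [this, Real.exp_add]
        gcongr
        have : Real.exp (3/4) ≤ Real.exp 1 := Real.exp_le_exp.2 (by norm_num)
        linarith [Real.exp_one_lt_d9]
      rw [eu] at hp
      set u := σ⁻¹ * x - σ⁻¹ * c0
      rw [eq2]
      calc f x * (σ^2 * u^2) ≤ (t * (3 * Real.exp (-(|x - c0| / σ)))) * (σ^2 * u^2) := by
            gcongr
            exact hd.trans (by gcongr)
        _ = (3 * t * σ^2) * (u^2 * Real.exp (-(|x - c0| / σ))) := by ring
        _ ≤ (3 * t * σ^2) * (26 * (1 + u^2)⁻¹) := by gcongr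
        _ = (78 * t * σ^2) * (1 + u^2)⁻¹ := by ring
        _ ≤ _ := by
          have : 0 ≤ 9/16 * σ^2 * f x := by positivity
          linarith
  -- second moment about c0
  have hexp : (fun x => f x * (x - c0)^2) = fun x => f x * (x - m)^2 + 
      ((2 * (m - c0)) * (f x * x) + ((m - c0)^2 - 2 * (m - c0) * m) * f x) := by
    ext x; ring
  have hi1 : Integrable (fun x => (2 * (m - c0)) * (f x * x) + ((m - c0)^2 - 2 * (m - c0) * m) * f x) :=
    (h3.const_mul _).add (h1.const_mul _)
  have hint : Integrable (fun x => f x * (x - c0)^2) := by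
    rw [hexp]; exact h2.add hi1
  have hval : ∫ x, f x * (x - c0)^2 = σ^2 + (m - c0)^2 := by
    rw [hexp, integral_add h2 hi1, integral_add (h3.const_mul _) (h1.const_mul _),
      integral_const_mul, integral_const_mul, h1', h2', h3']
    ring
  have hcauchy : Integrable (fun x : ℝ => (1 + (σ⁻¹ * x - σ⁻¹ * c0)^2)⁻¹) := by
    have := (integrable_inv_one_add_sq.comp_sub_right (σ⁻¹ * c0)).comp_mul_left' (inv_pos.2 hσ).ne'
    exact this
  have hcv : ∫ x : ℝ, (1 + (σ⁻¹ * x - σ⁻¹ * c0)^2)⁻¹ = σ * Real.pi := by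
    rw [Measure.integral_comp_mul_left (fun y => (1 + (y - σ⁻¹ * c0)^2)⁻¹) σ⁻¹,
      integral_sub_right_eq_self (fun y : ℝ => (1 + y^2)⁻¹), integral_univ_inv_one_add_sq,
      inv_inv, abs_of_pos hσ, smul_eq_mul]
  have hfin := integral_mono hint ((h1.const_mul _).add (hcauchy.const_mul _)) hpt
  simp only [Pi.add_apply] at hfin
  rw [hval, integral_add (h1.const_mul _) (hcauchy.const_mul _), integral_const_mul,
    integral_const_mul, h1', hcv] at hfin
  have e : 78 * t * σ^2 * (σ * Real.pi) = 78/1000 * Real.pi * σ^2 := by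
    rw [ht]; field_simp
  rw [e] at hfin
  have := Real.pi_lt_four
  nlinarith [sq_nonneg (m - c0), sq_pos_of_pos hσ]

/-- For a θ-periodic φ and a logconcave distribution of standard deviation σ > θ,
the integral of |φ| over one period is at most O(θ) times E|φ|. -/
theorem stmt_1 :
    ∃ C > (0:ℝ), ∀ (φ f : ℝ → ℝ) (θ σ : ℝ) (μ : Measure ℝ),
      0 < θ → θ < σ →
      Function.Periodic φ θ →
      (∀ x, 0 ≤ f x) →
      Convex ℝ {x | 0 < f x} →
      ConcaveOn ℝ {x | 0 < f x} (fun x => Real.log (f x)) →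
      μ = volume.withDensity (fun x => ENNReal.ofReal (f x)) →
      IsProbabilityMeasure μ →
      Integrable (fun x => x) μ →
      (∫ x, (x - ∫ y, y ∂μ)^2 ∂μ) = σ^2 →
      IntegrableOn φ (Icc 0 θ) volume →
      Integrable φ μ →
      ∫ x in Icc 0 θ, |φ x| ≤ C * θ * ∫ x, |φ x| ∂μ := by
  refine ⟨2000, by norm_num, ?_⟩
  intro φ f θ σ μ hθ hθσ hper hf0 _ hc hμ hprob hid hvar hφ hφμ
  have hσ : 0 < σ := hθ.trans hθσ
  have hm := meas_aux f hf0 hc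
  set m := ∫ y, y ∂μ with hmdef
  have hsq : Integrable (fun x => (x - m)^2) μ := by
    by_contra h
    rw [integral_undef h] at hvar
    have : 0 < σ^2 := by positivity
    linarith
  have hone : Integrable (fun _ => (1:ℝ)) μ := integrable_const _
  have honev : ∫ _, (1:ℝ) ∂μ = 1 := by simp
  have habs := hφμ.abs
  have hmdef' := hmdef.symm
  clear_value m
  subst hμ
  rw [dens_int f _ hf0 hm] at hid hsq hone habs
  rw [dens_eq f _ hf0 hm] at hvar honev hmdef' ⊢
  simp only [mul_one] at hone honev
  obtain ⟨a, ha⟩ := interval_aux f hf0 m σ hσ hc hone honev hsq hvar hid hmdef'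
  have hperA : Function.Periodic (fun x => |φ x|) θ := fun x => by simp [hper x]
  have hII : ∀ b c : ℝ, IntervalIntegrable (fun x => |φ x|) volume b c := by
    have h0 : IntervalIntegrable (fun x => |φ x|) volume 0 (0 + θ) := by
      rw [zero_add, intervalIntegrable_iff_integrableOn_Icc_of_le hθ.le]
      exact hφ.abs
    exact fun b c => hperA.intervalIntegrable hθ.ne' h0 b c
  have hP : ∫ x in Icc 0 θ, |φ x| = ∫ x in (0:ℝ)..θ, |φ x| := by
    rw [intervalIntegral.integral_of_le hθ.le, integral_Icc_eq_integral_Ioc]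
  set n := ⌊σ / θ⌋₊ with hn
  have hn1 : (n:ℝ) * θ ≤ σ := by
    have := Nat.floor_le (div_pos hσ hθ).le
    rwa [le_div_iff₀ hθ] at this
  have hn2 : σ ≤ 2 * (n * θ) := by
    have h1 := Nat.lt_floor_add_one (σ / θ)
    have h2 : 1 ≤ n := (Nat.one_le_floor_iff _).2 ((one_le_div hθ).2 hθσ.le)
    have h2' : (1:ℝ) ≤ n := by exact_mod_cast h2
    rw [← hn, div_lt_iff₀ hθ] at h1
    nlinarith
  have hnP : ∫ x in a..(a + n * θ), |φ x| = n * ∫ x in (0:ℝ)..θ, |φ x| := by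
    have := hperA.intervalIntegral_add_zsmul_eq n a hII
    simpa [hperA.intervalIntegral_add_eq a 0] using this
  have hle : a ≤ a + n * θ := by nlinarith
  have hlow : 1 / (1000 * σ) * (n * ∫ x in (0:ℝ)..θ, |φ x|) ≤ ∫ x, f x * |φ x| := by
    rw [← hnP, intervalIntegral.integral_of_le hle, ← integral_const_mul]
    calc _ ≤ ∫ x in Ioc a (a + n * θ), f x * |φ x| := by
          apply setIntegral_mono_on ((hII a (a + n * θ)).1.const_mul _) habs.integrableOn
            measurableSet_Ioc
          intro x hx
          exact mul_le_mul_of_nonneg_right (ha x ⟨hx.1.le, by linarith [hx.2]⟩) (abs_nonneg _)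
      _ ≤ _ := setIntegral_le_integral habs
          (Filter.Eventually.of_forall fun x => mul_nonneg (hf0 x) (abs_nonneg _))
  rw [hP]
  set P := ∫ x in (0:ℝ)..θ, |φ x| with hPd
  have hP0 : 0 ≤ P := intervalIntegral.integral_nonneg hθ.le fun x _ => abs_nonneg _
  calc P ≤ 2000 * θ * (1 / (1000 * σ) * (n * P)) := by
        have : 2000 * θ * (1 / (1000 * σ) * (n * P)) = (2 * (n * θ)) * P / σ := by
          field_simp; ring
        rw [this, le_div_iff₀ hσ]
        nlinarith
    _ ≤ _ := by gcongr
end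

section
/- Let φ: ℝ → [−1,1] be (M,δ,θ)-quasiperiodic, witnessed by a θ-periodic function φ̃ with |φ(x) − φ̃(x)| < δ for all |x| ≤ M. Suppose D is a logconcave distribution on ℝ with mean μ and standard deviation σ such that M > σ(1 + log(1/δ)) + |μ|. Then |E_{x∼D}[|φ(x)|] − E_{x∼D}[|φ̃(x)|]| ≤ C·δ for an absolute constant C. -/
open MeasureTheory Set

/-- four-point inequality -/
lemma lc_four {f : ℝ → ℝ} (hf0 : ∀ x, 0 ≤ f x)
    (hconc : ConcaveOn ℝ {x | 0 < f x} (fun x => Real.log (f x)))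
    {x y t : ℝ} (hxy : x ≤ y) (ht : 0 < t) : f x * f (y + t) ≤ f y * f (x + t) := by
  by_cases h1 : 0 < f x
  swap
  · have : f x = 0 := le_antisymm (not_lt.1 h1) (hf0 x)
    rw [this, zero_mul]; exact mul_nonneg (hf0 _) (hf0 _)
  by_cases h2 : 0 < f (y + t)
  swap
  · have : f (y+t) = 0 := le_antisymm (not_lt.1 h2) (hf0 _)
    rw [this, mul_zero]; exact mul_nonneg (hf0 _) (hf0 _)
  have hd : 0 < y - x + t := by linarith
  set a := (y - x) / (y - x + t) with ha
  have ha0 : 0 ≤ a := div_nonneg (by linarith) hd.le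
  have ha1 : 0 ≤ 1 - a := by
    rw [ha, sub_nonneg, div_le_one hd]; linarith
  have had : a * (y - x + t) = y - x := by rw [ha]; field_simp
  have e1 : (1 - a) • x + a • (y + t) = y := by
    simp only [smul_eq_mul]; linarith
  have e2 : a • x + (1 - a) • (y + t) = x + t := by
    simp only [smul_eq_mul]; linarith
  have i1 := hconc.2 (x := x) h1 (y := y + t) h2 ha1 ha0 (by ring)
  have i2 := hconc.2 (x := x) h1 (y := y + t) h2 ha0 ha1 (by ring)
  have m1 := hconc.1 (x := x) h1 (y := y + t) h2 ha1 ha0 (by ring)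
  have m2 := hconc.1 (x := x) h1 (y := y + t) h2 ha0 ha1 (by ring)
  rw [e1] at i1 m1
  rw [e2] at i2 m2
  simp only [mem_ofPred_eq] at m1 m2
  simp only [smul_eq_mul] at i1 i2
  rw [← Real.log_le_log_iff (mul_pos h1 h2) (mul_pos m1 m2), Real.log_mul h1.ne' h2.ne',
    Real.log_mul m1.ne' m2.ne']
  linarith

lemma lc_meas {f : ℝ → ℝ} (hf0 : ∀ x, 0 ≤ f x)
    (hconc : ConcaveOn ℝ {x | 0 < f x} (fun x => Real.log (f x))) : Measurable f := by
  refine measurable_of_Ioi fun c => ?_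
  rcases lt_trichotomy c 0 with h | h | h
  · have : f ⁻¹' Ioi c = univ := by
      ext x; simp [lt_of_lt_of_le h (hf0 x)]
    rw [this]; exact MeasurableSet.univ
  · subst h
    exact (hconc.1.ordConnected).measurableSet
  · have : f ⁻¹' Ioi c = {x | x ∈ {x | 0 < f x} ∧ Real.log c < Real.log (f x)} := by
      ext x
      simp only [mem_preimage, mem_Ioi, mem_ofPred_eq]
      constructor
      · intro hx; exact ⟨h.trans hx, Real.log_lt_log h hx⟩
      · rintro ⟨h1, h2⟩; exact (Real.log_lt_log_iff h h1).1 h2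
    rw [this]
    exact ((hconc.convex_gt _).ordConnected).measurableSet

lemma lc_struct {f : ℝ → ℝ} {μ : Measure ℝ} (hf0 : ∀ x, 0 ≤ f x)
    (hconc : ConcaveOn ℝ {x | 0 < f x} (fun x => Real.log (f x)))
    (hμ : μ = volume.withDensity (fun x => ENNReal.ofReal (f x)))
    (hp : IsProbabilityMeasure μ) :
    ∃ I : Set ℝ, I.OrdConnected ∧ μ Iᶜ = 0 ∧ (∀ x ∈ I, 0 < μ.real (Ioi x)) ∧
      ConvexOn ℝ I (fun x => - Real.log (μ.real (Ioi x))) ∧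
      StrictMonoOn (fun x => - Real.log (μ.real (Ioi x))) I ∧
      Continuous (fun x => μ.real (Ioi x)) := by
  have hm := lc_meas hf0 hconc
  have hmo : Measurable (fun x => ENNReal.ofReal (f x)) := hm.ennreal_ofReal
  have hlint : ∫⁻ x, ENNReal.ofReal (f x) = 1 := by
    have := hp.measure_univ
    rwa [hμ, withDensity_apply _ MeasurableSet.univ, Measure.restrict_univ] at this
  have hint : Integrable f := by
    refine ⟨hm.aestronglyMeasurable, ?_⟩
    rw [hasFiniteIntegral_iff_ofReal (Filter.Eventually.of_forall hf0), hlint]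
    exact ENNReal.one_lt_top
  have hG : ∀ s, MeasurableSet s → μ.real s = ∫ x in s, f x := by
    intro s hs
    rw [Measure.real, hμ, withDensity_apply _ hs,
      integral_eq_lintegral_of_nonneg_ae (Filter.Eventually.of_forall hf0)
        hm.aestronglyMeasurable]
  set G : ℝ → ℝ := fun x => μ.real (Ioi x) with hGdef
  have hGx : ∀ x, G x = ∫ u in Ioi x, f u := fun x => hG _ measurableSet_Ioi
  have hprim : ∀ x, G x = G 0 - ∫ u in (0:ℝ)..x, f u := by
    intro x
    rw [← intervalIntegral.integral_Ioi_sub_Ioi' hint.integrableOn hint.integrableOn, hGx, hGx]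
    ring
  have hGcont : Continuous G := by
    have : G = fun x => G 0 - ∫ u in (0:ℝ)..x, f u := funext hprim
    rw [this]
    exact continuous_const.sub
      (intervalIntegral.continuous_primitive (fun a b => hint.intervalIntegrable) 0)
  set S := {x | 0 < f x} with hS
  set I := interior S with hI
  have hIS : I ⊆ S := interior_subset
  have hIo : IsOpen I := isOpen_interior
  have hIc : Convex ℝ I := hconc.1.interior
  have hfc : ContinuousOn f I := by
    have h1 : ContinuousOn (fun x => Real.log (f x)) I :=
      ConcaveOn.continuousOn hIo (hconc.subset hIS hIc)
    refine (Real.continuous_exp.comp_continuousOn h1).congr ?_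
    intro x hx
    exact (Real.exp_log (hIS hx)).symm
  have hder : ∀ x ∈ I, HasDerivAt G (- f x) x := by
    intro x hx
    have : G = fun x => G 0 - ∫ u in (0:ℝ)..x, f u := funext hprim
    rw [this]
    have h2 := intervalIntegral.integral_hasDerivAt_right (a := 0) (b := x)
      hint.intervalIntegrable hm.stronglyMeasurable.stronglyMeasurableAtFilter
      (hfc.continuousAt (hIo.mem_nhds hx))
    exact h2.const_sub _
  have hGpos : ∀ x ∈ I, 0 < G x := by
    intro x hx
    rw [hGx]
    rw [setIntegral_pos_iff_support_of_nonneg_ae (Filter.Eventually.of_forall hf0)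
      hint.integrableOn]
    have hop : IsOpen (I ∩ Ioi x) := hIo.inter isOpen_Ioi
    have hne : (I ∩ Ioi x).Nonempty := by
      obtain ⟨ε, hε, hb⟩ := Metric.isOpen_iff.1 hIo x hx
      refine ⟨x + ε/2, hb ?_, ?_⟩
      · rw [Metric.mem_ball, Real.dist_eq]; rw [abs_lt]; constructor <;> linarith
      · simp only [mem_Ioi]; linarith
    refine lt_of_lt_of_le (hop.measure_pos volume hne) (measure_mono ?_)
    rintro y ⟨hy, hy2⟩
    exact ⟨(hIS hy).ne', hy2⟩
  have hshift : ∀ x, G x = ∫ t in Ioi (0:ℝ), f (x + t) := by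
    intro x
    rw [hGx]
    have := (measurePreserving_add_left volume x).setIntegral_preimage_emb
      (MeasurableEquiv.addLeft x).measurableEmbedding f (Ioi x)
    rw [← this]
    congr 2
    ext t; simp
  have hhaz : ∀ x y, x ≤ y → f x * G y ≤ f y * G x := by
    intro x y hxy
    rw [hshift, hshift, ← integral_const_mul, ← integral_const_mul]
    have hi : ∀ z, IntegrableOn (fun t => f (z + t)) (Ioi 0) :=
      fun z => (hint.comp_add_left z).integrableOn
    exact setIntegral_mono_on ((hi y).const_mul _) ((hi x).const_mul _) measurableSet_Ioi
      fun t ht => lc_four hf0 hconc hxy ht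
  have hgder : ∀ x ∈ I, HasDerivAt (fun x => - Real.log (G x)) (f x / G x) x := by
    intro x hx
    have := ((hder x hx).log (hGpos x hx).ne').neg
    have h : f x / G x = -(-f x / G x) := by ring
    rw [h]; exact this
  have hgc : ContinuousOn (fun x => - Real.log (G x)) I :=
    fun x hx => (hgder x hx).continuousAt.continuousWithinAt
  refine ⟨I, hIc.ordConnected, ?_, hGpos, ?_, ?_, hGcont⟩
  · have h1 : Iᶜ ⊆ f ⁻¹' {0} ∪ frontier S := by
      intro x hx
      by_cases h : x ∈ S
      · right; exact ⟨subset_closure h, hx⟩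
      · left; exact le_antisymm (not_lt.1 h) (hf0 x)
    refine measure_mono_null h1 (measure_union_null ?_ ?_)
    · rw [hμ, withDensity_apply _ (hm (measurableSet_singleton 0))]
      rw [setLIntegral_congr_fun (g := fun _ => 0) (hm (measurableSet_singleton 0))]
      · simp
      · intro x hx
        have : f x = 0 := hx
        simp [this]
    · rw [hμ]
      exact withDensity_absolutelyContinuous _ _ (hconc.1.addHaar_frontier volume)
  · refine MonotoneOn.convexOn_of_deriv hIc hgc ?_ ?_
    · rw [hIo.interior_eq]
      exact fun x hx => (hgder x hx).differentiableAt.differentiableWithinAt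
    · rw [hIo.interior_eq]
      intro x hx y hy hxy
      rw [(hgder x hx).deriv, (hgder y hy).deriv, div_le_div_iff₀ (hGpos x hx) (hGpos y hy)]
      exact hhaz x y hxy
  · refine strictMonoOn_of_deriv_pos hIc hgc ?_
    rw [hIo.interior_eq]
    intro x hx
    rw [(hgder x hx).deriv]
    exact div_pos (hIS hx) (hGpos x hx)

lemma lc_left {μ : Measure ℝ} [IsProbabilityMeasure μ] {I : Set ℝ} (hI : I.OrdConnected)
    (h0 : μ Iᶜ = 0) {a p : ℝ} (ha : a ∉ I) (hp : p ∈ I) (hap : a < p) :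
    μ.real (Ioi a) = 1 := by
  have h1 : (Ioi a)ᶜ ⊆ Iᶜ := by
    intro x hx hxI
    simp only [mem_compl_iff, mem_Ioi, not_lt] at hx
    exact ha (hI.out hxI hp ⟨hx, hap.le⟩)
  have h2 : μ.real (Ioi a)ᶜ = 0 := by
    rw [Measure.real, measure_mono_null h1 h0]; rfl
  rw [probReal_compl_eq_one_sub measurableSet_Ioi] at h2
  linarith

lemma lc_right {μ : Measure ℝ} [IsProbabilityMeasure μ] {I : Set ℝ} (hI : I.OrdConnected)
    (h0 : μ Iᶜ = 0) {a p : ℝ} (ha : a ∉ I) (hp : p ∈ I) (hap : p < a) :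
    μ.real (Ioi a) = 0 := by
  have h1 : (Ioi a) ⊆ Iᶜ := by
    intro x hx hxI
    exact ha (hI.out hp hxI ⟨hap.le, le_of_lt hx⟩)
  rw [Measure.real, measure_mono_null h1 h0]; rfl

lemma lc_law {μ : Measure ℝ} [IsProbabilityMeasure μ] {I : Set ℝ} (hI : I.OrdConnected)
    (h0 : μ Iᶜ = 0)
    (hmono : StrictMonoOn (fun x => - Real.log (μ.real (Ioi x))) I)
    (hcont : Continuous (fun x => μ.real (Ioi x))) {t : ℝ} (ht : 0 < t) :
    μ.real {x | t < - Real.log (μ.real (Ioi x))} = Real.exp (-t) := by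
  obtain ⟨p, hp⟩ : I.Nonempty := by
    by_contra h
    rw [not_nonempty_iff_eq_empty] at h
    rw [h] at h0; simp at h0
  have hcdf : ∀ x, μ.real (Ioi x) = 1 - ProbabilityTheory.cdf μ x := by
    intro x
    rw [ProbabilityTheory.cdf_eq_real, ← probReal_compl_eq_one_sub measurableSet_Iic, compl_Iic]
  have hlim1 : Filter.Tendsto (fun x => μ.real (Ioi x)) Filter.atTop (nhds 0) := by
    simp_rw [hcdf]
    simpa using (ProbabilityTheory.tendsto_cdf_atTop μ).const_sub 1
  have hlim2 : Filter.Tendsto (fun x => μ.real (Ioi x)) Filter.atBot (nhds 1) := by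
    simp_rw [hcdf]
    simpa using (ProbabilityTheory.tendsto_cdf_atBot μ).const_sub 1
  have e0 := Real.exp_pos (-t)
  have e1 : Real.exp (-t) < 1 := by rw [Real.exp_lt_one_iff]; linarith
  obtain ⟨c, hc⟩ : ∃ c, μ.real (Ioi c) = Real.exp (-t) := by
    obtain ⟨a, ha⟩ := (hlim1.eventually (gt_mem_nhds e0)).exists
    obtain ⟨b, hb⟩ := (hlim2.eventually (lt_mem_nhds e1)).exists
    exact mem_range_of_exists_le_of_exists_ge hcont ⟨a, ha.le⟩ ⟨b, hb.le⟩
  have hcI : c ∈ I := by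
    by_contra h
    rcases lt_trichotomy c p with h1 | h1 | h1
    · have := lc_left hI h0 h hp h1; linarith
    · exact h (h1 ▸ hp)
    · have := lc_right hI h0 h hp h1; linarith
  rw [← hc]
  refine measureReal_congr ?_
  have hae : ∀ᵐ x ∂μ, x ∈ I := h0
  filter_upwards [hae] with x hx
  have hgc : - Real.log (μ.real (Ioi c)) = t := by rw [hc, Real.log_exp]; ring
  have := hmono.lt_iff_lt hcI hx
  simp only [hgc] at this
  exact propext this

lemma sq_tail_integral {A : ℝ} (hA : 0 ≤ A) :
    ∫ t in (0:ℝ)..A^2, Real.exp (-√t) = 2 - 2 * (1 + A) * Real.exp (-A) := by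
  have hc : Continuous (fun t : ℝ => Real.exp (-√t)) := by fun_prop
  rw [intervalIntegral.integral_eq_sub_of_hasDerivAt_of_le
    (f := fun t => -(2 * (1 + √t) * Real.exp (-√t))) (sq_nonneg A) (by fun_prop) ?_
    (hc.intervalIntegrable _ _)]
  · simp only [Real.sqrt_sq hA, Real.sqrt_zero]
    simp
    ring
  · intro x hx
    have hs := Real.hasDerivAt_sqrt hx.1.ne'
    have hpos : 0 < √x := Real.sqrt_pos.2 hx.1
    have := (((hs.const_add 1).const_mul 2).mul hs.neg.exp).neg
    refine this.congr_deriv ?_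
    simp only [Pi.neg_apply]
    field_simp
    ring

lemma lc_moments {μ : Measure ℝ} [IsProbabilityMeasure μ] {g : ℝ → ℝ} (hgm : Measurable g)
    (hg0 : ∀ x, 0 ≤ g x) (hlaw : ∀ t, 0 < t → μ.real {x | t < g x} = Real.exp (-t))
    {A : ℝ} (hA : 0 ≤ A) :
    (∫ x, min (g x) A ∂μ) ≤ 1 ∧
      2 - 2 * (1 + A) * Real.exp (-A) ≤ ∫ x, (min (g x) A)^2 ∂μ ∧
      Integrable (fun x => min (g x) A) μ ∧ Integrable (fun x => (min (g x) A)^2) μ := by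
  have hY0 : ∀ x, 0 ≤ min (g x) A := fun x => le_min (hg0 x) hA
  have hYA : ∀ x, min (g x) A ≤ A := fun x => min_le_right _ _
  have hYm : Measurable (fun x => min (g x) A) := hgm.min measurable_const
  have hi1 : Integrable (fun x => min (g x) A) μ := by
    refine Integrable.of_bound hYm.aestronglyMeasurable A (Filter.Eventually.of_forall fun x => ?_)
    rw [Real.norm_eq_abs, abs_of_nonneg (hY0 x)]; exact hYA x
  have hi2 : Integrable (fun x => (min (g x) A)^2) μ := by
    refine Integrable.of_bound (hYm.pow_const 2).aestronglyMeasurable (A^2)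
      (Filter.Eventually.of_forall fun x => ?_)
    rw [Real.norm_eq_abs, abs_of_nonneg (sq_nonneg _)]
    exact pow_le_pow_left₀ (hY0 x) (hYA x) 2
  refine ⟨?_, ?_, hi1, hi2⟩
  · rw [hi1.integral_eq_integral_meas_lt (Filter.Eventually.of_forall hY0),
      ← integral_exp_neg_Ioi_zero]
    refine integral_mono_of_nonneg (Filter.Eventually.of_forall fun t => measureReal_nonneg)
      (integrableOn_exp_neg_Ioi 0) ?_
    filter_upwards [ae_restrict_mem measurableSet_Ioi] with t ht
    rw [← hlaw t ht]
    refine measureReal_mono ?_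
    intro x hx
    have hx' : t < min (g x) A := hx
    exact lt_of_lt_of_le hx' (min_le_left _ _)
  · rw [hi2.integral_eq_integral_meas_lt (Filter.Eventually.of_forall fun x => sq_nonneg _)]
    rw [← sq_tail_integral hA, intervalIntegral.integral_of_le (sq_nonneg A),
      integral_Ioc_eq_integral_Ioo]
    have hsupp : ∀ t, A^2 ≤ t → μ.real {x | t < (min (g x) A)^2} = 0 := by
      intro t ht
      have : {x | t < (min (g x) A)^2} = ∅ := by
        ext x
        simp only [mem_ofPred_eq, mem_empty_iff_false, iff_false, not_lt]
        exact (pow_le_pow_left₀ (hY0 x) (hYA x) 2).trans ht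
      rw [this]; simp
    have hsub : ∫ t in Ioi (0:ℝ), μ.real {x | t < (min (g x) A)^2}
        = ∫ t in Ioo 0 (A^2), μ.real {x | t < (min (g x) A)^2} := by
      refine setIntegral_eq_of_subset_of_forall_sdiff_eq_zero measurableSet_Ioi
        (fun t ht => ht.1) ?_
      rintro t ⟨ht, ht2⟩
      refine hsupp t ?_
      by_contra h
      exact ht2 ⟨ht, not_le.1 h⟩
    rw [hsub]
    refine le_of_eq (setIntegral_congr_fun measurableSet_Ioo ?_)
    intro t ht
    simp only
    rw [← hlaw _ (Real.sqrt_pos.2 ht.1)]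
    congr 1
    ext x
    simp only [mem_ofPred_eq]
    have hsA : √t < A := (Real.sqrt_lt ht.1.le hA).2 ht.2
    rw [← Real.sqrt_lt ht.1.le (hY0 x), lt_min_iff]
    exact ⟨fun h => ⟨h, hsA⟩, fun h => h.1⟩

lemma lc_key {μ : Measure ℝ} [IsProbabilityMeasure μ] {I : Set ℝ} {g : ℝ → ℝ}
    (h0 : μ Iᶜ = 0) (hgm : Measurable g)
    (hg0 : ∀ x, 0 ≤ g x) (hlaw : ∀ t, 0 < t → μ.real {x | t < g x} = Real.exp (-t))
    (hconv : ConvexOn ℝ I g) (hmono : StrictMonoOn g I)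
    {c σ : ℝ} (hint : Integrable (fun x => (x - c)^2) μ) (hvar : ∫ x, (x - c)^2 ∂μ = σ^2)
    {a b : ℝ} (ha : a ∈ I) (hb : b ∈ I) (hab : a < b) :
    1 - 2 * (1 + g a) * Real.exp (-g a) ≤ ((g b - g a) / (b - a))^2 * σ^2 := by
  set A := g a with hA
  have hA0 : 0 ≤ A := hg0 a
  obtain ⟨m1, m2, i1, i2⟩ := lc_moments hgm hg0 hlaw hA0
  set m := (g b - A) / (b - a) with hm
  have hm0 : 0 ≤ m := div_nonneg (sub_nonneg.2 (hmono ha hb hab).le) (by linarith)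
  -- Lipschitz
  have hseg : ∀ x ∈ I, ∀ y ∈ I, x ≤ y → y ≤ a → g y - g x ≤ m * (y - x) := by
    intro x hx y hy hxy hya
    rcases hxy.eq_or_lt with h | h
    · subst h; simp
    have s1 : (g y - g x) / (y - x) ≤ m := by
      rcases hya.eq_or_lt with h' | h'
      · subst h'
        exact hconv.slope_mono_adjacent hx hb h hab
      · exact (hconv.slope_mono_adjacent hx ha h h').trans
          (hconv.slope_mono_adjacent hy hb h' hab)
    rwa [div_le_iff₀ (by linarith)] at s1
  have hlip1 : ∀ x ∈ I, ∀ y ∈ I, x ≤ y → |min (g x) A - min (g y) A| ≤ m * (y - x) := by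
    intro x hx y hy hxy
    have hgxy : g x ≤ g y := hmono.monotoneOn hx hy hxy
    rw [abs_sub_comm, abs_of_nonneg (sub_nonneg.2 (min_le_min_right A hgxy))]
    rcases le_total y a with hya | hya
    · have e1 : g y ≤ A := hmono.monotoneOn hy ha hya
      rw [min_eq_left e1, min_eq_left (hgxy.trans e1)]
      exact hseg x hx y hy hxy hya
    · have e1 : A ≤ g y := hmono.monotoneOn ha hy hya
      rw [min_eq_right e1]
      rcases le_total x a with hxa | hxa
      · have e2 : g x ≤ A := hmono.monotoneOn hx ha hxa
        rw [min_eq_left e2]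
        refine (hseg x hx a ha hxa le_rfl).trans ?_
        exact mul_le_mul_of_nonneg_left (by linarith) hm0
      · have e2 : A ≤ g x := hmono.monotoneOn ha hx hxa
        rw [min_eq_right e2, sub_self]
        exact mul_nonneg hm0 (by linarith)
  have hlip : LipschitzOnWith (Real.toNNReal m) (fun x => min (g x) A) I := by
    refine LipschitzOnWith.of_dist_le_mul fun x hx y hy => ?_
    rw [Real.coe_toNNReal m hm0, Real.dist_eq, Real.dist_eq]
    rcases le_total x y with h | h
    · rw [abs_sub_comm x y, abs_of_nonneg (sub_nonneg.2 h)]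
      exact hlip1 x hx y hy h
    · rw [abs_of_nonneg (sub_nonneg.2 h), abs_sub_comm]
      exact hlip1 y hy x hx h
  obtain ⟨k, hk, hkeq⟩ := hlip.extend_real
  have hae : ∀ᵐ x ∂μ, x ∈ I := h0
  set d := k c with hd
  have hle : ∫ x, (min (g x) A - d)^2 ∂μ ≤ ∫ x, m^2 * (x - c)^2 ∂μ := by
    refine integral_mono_of_nonneg (Filter.Eventually.of_forall fun x => sq_nonneg _)
      (hint.const_mul _) ?_
    filter_upwards [hae] with x hx
    have h1 := hk.dist_le_mul x c
    rw [Real.coe_toNNReal m hm0, Real.dist_eq, Real.dist_eq, ← hkeq hx] at h1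
    have h2 := pow_le_pow_left₀ (abs_nonneg _) h1 2
    rwa [mul_pow, sq_abs, sq_abs] at h2
  rw [integral_const_mul, hvar] at hle
  have hexp : ∫ x, (min (g x) A - d)^2 ∂μ
      = (∫ x, (min (g x) A)^2 ∂μ) - 2 * d * (∫ x, min (g x) A ∂μ) + d^2 := by
    have : ∀ x, (min (g x) A - d)^2 = (min (g x) A)^2 - 2 * d * (min (g x) A) + d^2 :=
      fun x => by ring
    simp_rw [this]
    have i3 : Integrable (fun x => (min (g x) A)^2 - 2 * d * (min (g x) A)) μ :=
      i2.sub (i1.const_mul _)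
    rw [integral_add i3 (integrable_const _),
      integral_sub i2 (i1.const_mul _), integral_const_mul]
    simp
  have hE0 : 0 ≤ ∫ x, min (g x) A ∂μ := integral_nonneg fun x => le_min (hg0 x) hA0
  rw [hexp] at hle
  set E := ∫ x, min (g x) A ∂μ
  have : E^2 ≤ 1 := by nlinarith
  nlinarith [sq_nonneg (d - E)]

lemma lc_step {μ : Measure ℝ} [IsProbabilityMeasure μ] {I : Set ℝ} {g : ℝ → ℝ}
    (h0 : μ Iᶜ = 0) (hgm : Measurable g)
    (hg0 : ∀ x, 0 ≤ g x) (hlaw : ∀ t, 0 < t → μ.real {x | t < g x} = Real.exp (-t))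
    (hconv : ConvexOn ℝ I g) (hmono : StrictMonoOn g I)
    {c σ : ℝ} (hint : Integrable (fun x => (x - c)^2) μ) (hvar : ∫ x, (x - c)^2 ∂μ = σ^2)
    (hσ : 0 < σ) {a : ℝ} (ha : a ∈ I) (hb : a + σ ∈ I) :
    g a + 1 - 4 * Real.exp (-(g a / 2)) ≤ g (a + σ) := by
  have h := lc_key h0 hgm hg0 hlaw hconv hmono hint hvar ha hb (by linarith)
  have e1 : ((g (a + σ) - g a) / (a + σ - a))^2 * σ^2 = (g (a+σ) - g a)^2 := by
    rw [add_sub_cancel_left]; field_simp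
  rw [e1] at h
  have hd : 0 ≤ g (a+σ) - g a := sub_nonneg.2 (hmono ha hb (by linarith)).le
  have e2 : Real.exp (-g a) = Real.exp (-(g a/2)) * Real.exp (-(g a/2)) := by
    rw [← Real.exp_add]; congr 1; ring
  have e3 : g a / 2 + 1 ≤ Real.exp (g a / 2) := Real.add_one_le_exp _
  have e4 : Real.exp (g a / 2) * Real.exp (-(g a/2)) = 1 := by
    rw [← Real.exp_add]; simp
  have p := Real.exp_pos (-(g a/2))
  have e5 : 2 * (1 + g a) * Real.exp (-g a) ≤ 4 * Real.exp (-(g a / 2)) := by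
    rw [e2]
    have : (1 + g a) * Real.exp (-(g a/2)) ≤ 2 := by
      have := mul_le_mul_of_nonneg_right e3 p.le
      have := mul_nonneg (hg0 a) p.le
      nlinarith
    nlinarith
  rcases le_total (g (a+σ) - g a) 1 with h1 | h1
  · nlinarith
  · linarith

lemma lc_iter {u : ℕ → ℝ} {N : ℕ} (hu0 : Real.log 64 ≤ u 0)
    (hu : ∀ n < N, u n + 1 - 4 * Real.exp (-(u n / 2)) ≤ u (n+1)) :
    ∀ n ≤ N, Real.log 64 + n / 2 ≤ u n ∧ (n:ℝ) - 3 + 3 * Real.exp (-(1/4)) ^ n ≤ u n := by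
  intro n
  have hlog3 : 0 ≤ Real.log 64 := Real.log_nonneg (by norm_num)
  have hr : Real.exp (-(1/4)) ≤ 5/6 := by
    rw [Real.exp_neg, inv_le_comm₀ (Real.exp_pos _) (by norm_num)]
    have := Real.add_one_le_exp (1/4 : ℝ)
    linarith
  induction n with
  | zero => intro _; simp; exact ⟨hu0, hlog3.trans hu0⟩
  | succ n ih =>
    intro hn
    obtain ⟨h1, h2⟩ := ih (by omega)
    have h3 := hu n (by omega)
    have hr0 := Real.exp_pos (-(1/4))
    have hq : Real.exp (-(u n / 2)) ≤ 1/8 * Real.exp (-(1/4)) ^ n := by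
      have e8 : (1/8:ℝ) = Real.exp (-(Real.log 64 / 2)) := by
        have : Real.log 64 = 2 * Real.log 8 := by
          rw [show (64:ℝ) = 8^2 by norm_num, Real.log_pow]; norm_num
        rw [this, mul_div_cancel_left₀ _ (by norm_num), Real.exp_neg, Real.exp_log (by norm_num)]
        norm_num
      rw [e8, ← Real.exp_nat_mul, ← Real.exp_add]
      apply Real.exp_le_exp.2
      linarith
    have hp0 : 0 < Real.exp (-(1/4)) ^ n := pow_pos hr0 n
    have hp1 : Real.exp (-(1/4)) ^ n ≤ 1 := pow_le_one₀ hr0.le (by linarith)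
    push_cast
    constructor
    · linarith
    · rw [pow_succ]
      nlinarith

lemma lc_tail {f : ℝ → ℝ} {μ : Measure ℝ} (hf0 : ∀ x, 0 ≤ f x)
    (hconc : ConcaveOn ℝ {x | 0 < f x} (fun x => Real.log (f x)))
    (hμ : μ = volume.withDensity (fun x => ENNReal.ofReal (f x)))
    (hp : IsProbabilityMeasure μ) {c σ : ℝ}
    (hint : Integrable (fun x => (x - c)^2) μ) (hvar : ∫ x, (x - c)^2 ∂μ = σ^2)
    (hσ : 0 < σ) (t : ℝ) : μ.real (Ioi (c + σ * (1 + t))) ≤ Real.exp (11 - t) := by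
  obtain ⟨I, hI, h0, hpos, hconv, hmono, hcont⟩ := lc_struct hf0 hconc hμ hp
  have hlaw := fun t (ht : 0 < t) => lc_law hI h0 hmono hcont ht
  set g : ℝ → ℝ := fun x => - Real.log (μ.real (Ioi x)) with hg
  have hgm : Measurable g := (Real.measurable_log.comp hcont.measurable).neg
  have hg0 : ∀ x, 0 ≤ g x := fun x =>
    neg_nonneg.2 (Real.log_nonpos measureReal_nonneg measureReal_le_one)
  rcases lt_or_ge t 7 with ht | ht
  · exact measureReal_le_one.trans (Real.one_le_exp (by linarith))
  set N := ⌊t - 7⌋₊ with hN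
  have hN1 : (N:ℝ) ≤ t - 7 := Nat.floor_le (by linarith)
  have hN2 : t - 7 < N + 1 := Nat.lt_floor_add_one _
  set a0 := c + 8 * σ with ha0
  have hmon : μ.real (Ioi (c + σ * (1 + t))) ≤ μ.real (Ioi (a0 + N * σ)) := by
    refine measureReal_mono (Ioi_subset_Ioi ?_)
    rw [ha0]; nlinarith
  refine hmon.trans ?_
  have hcheb : μ.real (Ioi a0) ≤ 1/64 := by
    have h1 := mul_meas_ge_le_integral_of_nonneg
      (Filter.Eventually.of_forall fun x => sq_nonneg (x - c)) hint (64 * σ^2)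
    rw [hvar] at h1
    have h2 : μ.real (Ioi a0) ≤ μ.real {x | 64 * σ^2 ≤ (x - c)^2} := by
      refine measureReal_mono ?_
      intro x hx
      have hx' : c + 8 * σ < x := hx
      show 64 * σ^2 ≤ (x - c)^2
      nlinarith
    have hs : 0 < σ^2 := by positivity
    have h3 : 64 * μ.real {x | 64 * σ^2 ≤ (x - c)^2} ≤ 1 := by
      by_contra h
      push Not at h
      nlinarith
    linarith
  by_cases hmem : a0 + N * σ ∈ I
  swap
  · obtain ⟨p, hp'⟩ : I.Nonempty := by
      by_contra h
      rw [not_nonempty_iff_eq_empty] at h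
      rw [h] at h0; simp at h0
    rcases lt_trichotomy (a0 + N * σ) p with h1 | h1 | h1
    · have h2 := lc_left hI h0 hmem hp' h1
      have h3 : μ.real (Ioi (a0 + N * σ)) ≤ μ.real (Ioi a0) :=
        measureReal_mono (Ioi_subset_Ioi (by
          have : 0 ≤ (N:ℝ) * σ := by positivity
          linarith))
      linarith
    · exact absurd (h1 ▸ hp') hmem
    · rw [lc_right hI h0 hmem hp' h1]; exact (Real.exp_pos _).le
  have ha0I : a0 ∈ I := by
    by_contra h
    have hN0 : 0 < (N:ℝ) * σ := by
      rcases (by positivity : 0 ≤ (N:ℝ) * σ).eq_or_lt with h' | h'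
      · rw [← h', add_zero] at hmem; exact absurd hmem h
      · exact h'
    have := lc_left hI h0 h hmem (by linarith)
    linarith
  have hall : ∀ n ≤ N, a0 + n * σ ∈ I := by
    intro n hn
    have hn' : (n:ℝ) ≤ N := by exact_mod_cast hn
    refine hI.out ha0I hmem ⟨?_, ?_⟩
    · have : 0 ≤ (n:ℝ) * σ := by positivity
      linarith
    · nlinarith
  have hit := lc_iter (u := fun n => g (a0 + n * σ)) (N := N) ?_ ?_ N le_rfl
  · have h2 := hit.2
    have hr0 := pow_pos (Real.exp_pos (-(1/4))) N
    have h3 : -g (a0 + N * σ) ≤ 11 - t := by linarith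
    have h4 : μ.real (Ioi (a0 + N * σ)) = Real.exp (-g (a0 + N * σ)) := by
      rw [hg]; simp only [neg_neg]; rw [Real.exp_log (hpos _ hmem)]
    rw [h4]
    exact Real.exp_le_exp.2 h3
  · simp only [Nat.cast_zero, zero_mul, add_zero]
    have := Real.log_le_log (hpos _ ha0I) hcheb
    rw [one_div, Real.log_inv] at this
    simp only [hg]
    linarith
  · intro n hn
    have h1 := hall n hn.le
    have h2 := hall (n+1) hn
    have e : a0 + ((n+1 : ℕ):ℝ) * σ = a0 + n * σ + σ := by push_cast; ring
    rw [e] at h2 ⊢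
    exact lc_step h0 hgm hg0 hlaw hconv hmono hint hvar hσ h1 h2

lemma lc_tail_left {f : ℝ → ℝ} {μ : Measure ℝ} (hf0 : ∀ x, 0 ≤ f x)
    (hconc : ConcaveOn ℝ {x | 0 < f x} (fun x => Real.log (f x)))
    (hμ : μ = volume.withDensity (fun x => ENNReal.ofReal (f x)))
    (hp : IsProbabilityMeasure μ) {c σ : ℝ}
    (hint : Integrable (fun x => (x - c)^2) μ) (hvar : ∫ x, (x - c)^2 ∂μ = σ^2)
    (hσ : 0 < σ) (t : ℝ) : μ.real (Iio (c - σ * (1 + t))) ≤ Real.exp (11 - t) := by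
  have hme : MeasurableEmbedding (fun x : ℝ => -x) := (MeasurableEquiv.neg ℝ).measurableEmbedding
  set ν := μ.map (fun x => -x) with hν
  have hm := lc_meas hf0 hconc
  have hνp : IsProbabilityMeasure ν := Measure.isProbabilityMeasure_map measurable_neg.aemeasurable
  have hνd : ν = volume.withDensity (fun x => ENNReal.ofReal (f (-x))) := by
    ext s hs
    rw [hν, Measure.map_apply measurable_neg hs, hμ, withDensity_apply _ (measurable_neg hs),
      withDensity_apply _ hs]
    have := (Measure.measurePreserving_neg (volume : Measure ℝ)).setLIntegral_comp_preimage hs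
      (f := fun x => ENNReal.ofReal (f (-x))) (by fun_prop)
    rw [← this]
    simp
  have hconc' : ConcaveOn ℝ {x | 0 < f (-x)} (fun x => Real.log (f (-x))) :=
    hconc.comp_linearMap (-LinearMap.id)
  have hsq : ∀ x : ℝ, (-x - -c)^2 = (x - c)^2 := fun x => by ring
  have hint' : Integrable (fun x => (x - -c)^2) ν := by
    rw [hν, hme.integrable_map_iff]
    exact hint.congr (Filter.Eventually.of_forall fun x => (hsq x).symm)
  have hvar' : ∫ x, (x - -c)^2 ∂ν = σ^2 := by
    rw [hν, hme.integral_map, ← hvar]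
    exact integral_congr_ae (Filter.Eventually.of_forall hsq)
  have h := lc_tail (fun x => hf0 (-x)) hconc' hνd hνp hint' hvar' hσ t
  refine le_trans (le_of_eq ?_) h
  rw [hν, map_measureReal_apply measurable_neg measurableSet_Ioi]
  congr 1
  ext x
  simp only [mem_Iio, mem_preimage, mem_Ioi]
  constructor <;> intro h <;> linarith

/-- For a (M,δ,θ)-quasiperiodic φ with periodic witness φ̃, and a logconcave
distribution with mean μm, std σ, and M > σ(1 + log(1/δ)) + |μm|, the expectations
of |φ| and |φ̃| differ by O(δ). -/
theorem stmt_2 :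
    ∃ C > (0:ℝ), ∀ (φ φt f : ℝ → ℝ) (M δ θ μm σ : ℝ) (μ : Measure ℝ),
      0 < θ → 0 < δ → δ < 1 →
      (∀ x, φ x ∈ Icc (-1:ℝ) 1) →
      Measurable φ → Measurable φt →
      Function.Periodic φt θ →
      (∀ x, |φt x| ≤ 1) →
      (∀ x, |x| ≤ M → |φ x - φt x| < δ) →
      (∀ x, 0 ≤ f x) →
      Convex ℝ {x | 0 < f x} →
      ConcaveOn ℝ {x | 0 < f x} (fun x => Real.log (f x)) →
      μ = volume.withDensity (fun x => ENNReal.ofReal (f x)) →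
      IsProbabilityMeasure μ →
      (∫ x, x ∂μ) = μm →
      (∫ x, (x - μm)^2 ∂μ) = σ^2 →
      0 < σ →
      σ * (1 + Real.log (1/δ)) + |μm| < M →
      |(∫ x, |φ x| ∂μ) - ∫ x, |φt x| ∂μ| ≤ C * δ := by
  refine ⟨1 + 4 * Real.exp 11, by positivity, ?_⟩
  intro φ φt f M δ θ c σ μ _ hδ _ hφ hφm hφtm _ hφt hclose hf0 _ hconc hμ hp _ hvar hσ hM
  have hint : Integrable (fun x => (x - c)^2) μ := by
    by_contra h
    rw [integral_undef h] at hvar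
    have : 0 < σ^2 := by positivity
    linarith
  set t := Real.log (1/δ) with ht
  have hexp : Real.exp (11 - t) = Real.exp 11 * δ := by
    rw [Real.exp_sub, ht, Real.exp_log (by positivity)]; field_simp
  have hR := lc_tail hf0 hconc hμ hp hint hvar hσ t
  have hL := lc_tail_left hf0 hconc hμ hp hint hvar hσ t
  rw [hexp] at hR hL
  set T := Ioi (c + σ * (1 + t)) ∪ Iio (c - σ * (1 + t)) with hT
  have hTm : MeasurableSet T := measurableSet_Ioi.union measurableSet_Iio
  have hTle : μ.real T ≤ 2 * (Real.exp 11 * δ) :=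
    (measureReal_union_le _ _).trans (by linarith)
  have hφ1 : ∀ x, |φ x| ≤ 1 := fun x => abs_le.2 ⟨(hφ x).1, (hφ x).2⟩
  have i1 : Integrable (fun x => |φ x|) μ :=
    Integrable.of_bound hφm.abs.aestronglyMeasurable 1
      (Filter.Eventually.of_forall fun x => by simpa using hφ1 x)
  have i2 : Integrable (fun x => |φt x|) μ :=
    Integrable.of_bound hφtm.abs.aestronglyMeasurable 1
      (Filter.Eventually.of_forall fun x => by simpa using hφt x)
  rw [← integral_sub i1 i2]
  have i3 : Integrable (T.indicator (fun _ => (2:ℝ))) μ := (integrable_const 2).indicator hTm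
  calc |∫ x, (|φ x| - |φt x|) ∂μ| ≤ ∫ x, |(|φ x| - |φt x|)| ∂μ := abs_integral_le_integral_abs
    _ ≤ ∫ x, (δ + T.indicator (fun _ => (2:ℝ)) x) ∂μ := by
        refine integral_mono (i1.sub i2).abs ((integrable_const δ).add i3) fun x => ?_
        by_cases hx : x ∈ T
        · simp only [indicator_of_mem hx]
          have := abs_le.1 (hφ1 x)
          rw [abs_le]
          constructor <;> linarith [abs_nonneg (φ x), abs_nonneg (φt x), hφ1 x, hφt x]
        · simp only [indicator_of_notMem hx, add_zero]
          refine (abs_abs_sub_abs_le _ _).trans (hclose x ?_).le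
          simp only [hT, mem_union, mem_Ioi, mem_Iio, not_or, not_lt] at hx
          rw [abs_le]
          constructor <;> linarith [neg_abs_le c, le_abs_self c]
    _ = δ + 2 * μ.real T := by
        rw [integral_add (integrable_const δ) i3, integral_indicator hTm]
        simp [mul_comm]
    _ ≤ (1 + 4 * Real.exp 11) * δ := by linarith
end

section
/- Let φ: ℝ → [−1,1] be (M,δ,θ)-quasiperiodic and let D be a logconcave distribution on ℝ with mean μ and standard deviation σ > θ. Then for any z ∈ ℝ with |z| < M − σ(1 + log(1/δ)) − |μ|: |E_{x∼D}[φ(x)] − E_{x∼D}[φ(x − z)]| ≤ C·(δ + (θ/σ)·E_{x∼D}[|φ(x)|]) for an absolute constant C. -/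
open MeasureTheory Set

/-- Data of a logconcave density with mean `m` and standard deviation `σ`. -/
structure LC (f : ℝ → ℝ) (m σ : ℝ) : Prop where
  nn : ∀ x, 0 ≤ f x
  conv : Convex ℝ {x | 0 < f x}
  conc : ConcaveOn ℝ {x | 0 < f x} (fun x => Real.log (f x))
  int : Integrable f
  one : ∫ x, f x = 1
  int1 : Integrable (fun x => (x - m) * f x)
  mean : ∫ x, (x - m) * f x = 0
  int2 : Integrable (fun x => (x - m)^2 * f x)
  var : ∫ x, (x - m)^2 * f x = σ^2
  pos : 0 < σ

theorem lc_aem {f : ℝ → ℝ} (nn : ∀ x, 0 ≤ f x) (conv : Convex ℝ {x | 0 < f x})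
    (conc : ConcaveOn ℝ {x | 0 < f x} (fun x => Real.log (f x))) :
    ContinuousOn f (interior {x | 0 < f x}) ∧
    (∀ᵐ x, x ∉ interior {x | 0 < f x} → f x = 0) ∧ AEMeasurable f := by
  have h1 : ContinuousOn f (interior {x | 0 < f x}) := by
    have := conc.continuousOn_interior
    have h2 := Real.continuous_exp.comp_continuousOn this
    refine h2.congr ?_
    intro x hx
    have : x ∈ {x | 0 < f x} := interior_subset hx
    have : 0 < f x := this
    simp [Real.exp_log this]
  have h2 : ∀ᵐ x, x ∉ interior {x | 0 < f x} → f x = 0 := by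
    have h0 := conv.addHaar_frontier volume
    have : ∀ᵐ x, x ∉ frontier {x | 0 < f x} := by
      exact measure_eq_zero_iff_ae_notMem.1 h0
    filter_upwards [this] with x hx hxi
    by_contra hne
    have : 0 < f x := lt_of_le_of_ne (nn x) (Ne.symm hne)
    exact hx ⟨subset_closure this, hxi⟩
  refine ⟨h1, h2, ?_⟩
  have h3 : AEMeasurable ((interior {x | 0 < f x}).indicator f) := by
    rw [aemeasurable_indicator_iff isOpen_interior.measurableSet]
    exact h1.aemeasurable isOpen_interior.measurableSet
  refine h3.congr ?_
  filter_upwards [h2] with x hx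
  by_cases hxi : x ∈ interior {x | 0 < f x}
  · simp [hxi]
  · simp [hxi, hx hxi]

theorem LC.pair {f : ℝ → ℝ} {m σ : ℝ} (h : LC f m σ) {x y s : ℝ} (hxy : x ≤ y) (hs : 0 ≤ s) :
    f x * f (y + s) ≤ f y * f (x + s) := by
  rcases (h.nn x).eq_or_lt with h0 | hx
  · rw [← h0, zero_mul]; exact mul_nonneg (h.nn _) (h.nn _)
  rcases (h.nn (y + s)).eq_or_lt with h0 | hy
  · rw [← h0, mul_zero]; exact mul_nonneg (h.nn _) (h.nn _)
  rcases hxy.eq_or_lt with rfl | hlt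
  · exact le_rfl
  have hL : 0 < y + s - x := by linarith
  have a0 : 0 ≤ s / (y + s - x) := by positivity
  have b0 : 0 ≤ (y - x) / (y + s - x) := div_nonneg (by linarith) hL.le
  have ab : s / (y + s - x) + (y - x) / (y + s - x) = 1 := by field_simp; ring
  have e1 : s / (y + s - x) * x + (y - x) / (y + s - x) * (y + s) = y := by
    field_simp; ring
  have e2 : (y - x) / (y + s - x) * x + s / (y + s - x) * (y + s) = x + s := by
    field_simp; ring
  have c1 := h.conc.2 hx hy a0 b0 ab
  have c2 := h.conc.2 hx hy b0 a0 (by rw [add_comm]; exact ab)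
  have p1 := h.conv hx hy a0 b0 ab
  have p2 := h.conv hx hy b0 a0 (by rw [add_comm]; exact ab)
  simp only [smul_eq_mul, e1, e2, mem_ofPred_eq] at c1 c2 p1 p2
  have : Real.log (f x * f (y + s)) ≤ Real.log (f y * f (x + s)) := by
    rw [Real.log_mul hx.ne' hy.ne', Real.log_mul p1.ne' p2.ne']
    have hb : (y - x) / (y + s - x) = 1 - s / (y + s - x) := by linarith
    rw [hb] at c1 c2
    nlinarith
  exact (Real.log_le_log_iff (mul_pos hx hy) (mul_pos p1 p2)).1 this

theorem LC.quasi {f : ℝ → ℝ} {m σ : ℝ} (h : LC f m σ) {x y w : ℝ} (hxy : x ≤ y) (hyw : y ≤ w) :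
    min (f x) (f w) ≤ f y := by
  by_contra hc
  push Not at hc
  have h1 := lt_min_iff.1 hc
  rcases hxy.eq_or_lt with rfl | hxy
  · simp at h1
  rcases hyw.eq_or_lt with rfl | hyw
  · simp at h1
  have hx : 0 < f x := lt_of_le_of_lt (h.nn _) h1.1
  have hw : 0 < f w := lt_of_le_of_lt (h.nn _) h1.2
  have hL : 0 < w - x := by linarith
  have a0 : 0 ≤ (w - y) / (w - x) := div_nonneg (by linarith) hL.le
  have b0 : 0 ≤ (y - x) / (w - x) := div_nonneg (by linarith) hL.le
  have ab : (w - y) / (w - x) + (y - x) / (w - x) = 1 := by field_simp; ring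
  have e1 : (w - y) / (w - x) * x + (y - x) / (w - x) * w = y := by
    field_simp; ring
  have c1 := h.conc.2 hx hw a0 b0 ab
  have p1 := h.conv hx hw a0 b0 ab
  simp only [smul_eq_mul, e1, mem_ofPred_eq] at c1 p1
  have l1 := Real.log_lt_log p1 h1.1
  have l2 := Real.log_lt_log p1 h1.2
  have hb : (y - x) / (w - x) = 1 - (w - y) / (w - x) := by linarith
  have a1 : 0 < (w - y) / (w - x) := div_pos (by linarith) hL
  rw [hb] at c1 b0
  nlinarith [mul_pos a1 (sub_pos.2 l1), mul_nonneg b0 (sub_pos.2 l2).le]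

/-- exponential decay -/
theorem LC.decay {f : ℝ → ℝ} {m σ : ℝ} (h : LC f m σ) {p q x d κ : ℝ} (hpq : p < q) (hqx : q ≤ x)
    (hd : q - p ≤ d) (hp : 0 < f p) (hκ : 0 ≤ κ) (hq : f q ≤ f p * Real.exp (-κ)) :
    f x ≤ f p * Real.exp (-(κ / d) * |x - p|) := by
  rw [abs_of_pos (by linarith)]
  rcases (h.nn x).eq_or_lt with h0 | hx
  · rw [← h0]; positivity
  have hL : 0 < x - p := by linarith
  have hd0 : 0 < d := by linarith
  have a0 : 0 ≤ (x - q) / (x - p) := div_nonneg (by linarith) hL.le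
  have b0 : 0 ≤ (q - p) / (x - p) := div_nonneg (by linarith) hL.le
  have ab : (x - q) / (x - p) + (q - p) / (x - p) = 1 := by field_simp; ring
  have e1 : (x - q) / (x - p) * p + (q - p) / (x - p) * x = q := by
    field_simp; ring
  have c1 := h.conc.2 hp hx a0 b0 ab
  have p1 := h.conv hp hx a0 b0 ab
  simp only [smul_eq_mul, e1, mem_ofPred_eq] at c1 p1
  have l1 : Real.log (f q) ≤ Real.log (f p) - κ := by
    have := Real.log_le_log p1 hq
    rw [Real.log_mul hp.ne' (Real.exp_pos _).ne', Real.log_exp] at this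
    linarith
  have hb : (x - q) / (x - p) = 1 - (q - p) / (x - p) := by linarith
  rw [hb] at c1
  have c2 : (q - p) / (x - p) * (Real.log (f x) - Real.log (f p)) ≤ -κ := by nlinarith
  have c3 : (q - p) * (Real.log (f x) - Real.log (f p)) ≤ -κ * (x - p) := by
    have := mul_le_mul_of_nonneg_right c2 hL.le
    have e : (q - p) / (x - p) * (Real.log (f x) - Real.log (f p)) * (x - p)
      = (q - p) * (Real.log (f x) - Real.log (f p)) := by field_simp
    linarith
  have c4 : Real.log (f x) - Real.log (f p) ≤ -(κ / d) * (x - p) := by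
    have hneg : Real.log (f x) - Real.log (f p) ≤ 0 := by
      by_contra hc
      push Not at hc
      have := mul_pos (sub_pos.2 hpq) hc
      nlinarith [mul_nonneg hκ hL.le]
    have : d * (Real.log (f x) - Real.log (f p)) ≤ -κ * (x - p) := by nlinarith
    have e : -(κ / d) * (x - p) = (-κ * (x - p)) / d := by ring
    rw [e, le_div_iff₀ hd0]; linarith
  calc f x = Real.exp (Real.log (f x)) := (Real.exp_log hx).symm
    _ ≤ Real.exp (Real.log (f p) + -(κ / d) * (x - p)) := Real.exp_le_exp.2 (by linarith)
    _ = _ := by rw [Real.exp_add, Real.exp_log hp]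

/-- reflection -/
theorem LC.reflect {f : ℝ → ℝ} {m σ : ℝ} (h : LC f m σ) : LC (fun x => f (-x)) (-m) σ where
  nn x := h.nn _
  conv := by
    intro x hx y hy a b ha hb hab
    have := h.conv hx hy ha hb hab
    simp only [mem_ofPred_eq, smul_eq_mul] at this ⊢
    convert this using 2; ring
  conc := by
    refine ⟨?_, ?_⟩
    · intro x hx y hy a b ha hb hab
      have := h.conv hx hy ha hb hab
      simp only [mem_ofPred_eq, smul_eq_mul] at this ⊢
      convert this using 2; ring
    · intro x hx y hy a b ha hb hab
      have := h.conc.2 hx hy ha hb hab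
      simp only [smul_eq_mul] at this ⊢
      convert this using 3; ring
  int := h.int.comp_neg
  one := by rw [integral_neg_eq_self (fun x => f x)]; exact h.one
  int1 := by
    have := h.int1.comp_neg.neg
    refine this.congr (Filter.Eventually.of_forall fun x => ?_)
    simp only [Pi.neg_apply]; ring
  mean := by
    have := integral_neg_eq_self (fun x => (x - m) * f x) volume
    rw [h.mean] at this
    rw [← neg_eq_zero, ← integral_neg, ← this]
    congr 1; ext x; ring
  int2 := by
    have := h.int2.comp_neg
    refine this.congr (Filter.Eventually.of_forall fun x => ?_)
    simp only; ring
  var := by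
    have := integral_neg_eq_self (fun x => (x - m)^2 * f x) volume
    rw [h.var] at this
    rw [← this]
    congr 1; ext x; ring
  pos := h.pos

theorem LC.decay_left {f : ℝ → ℝ} {m σ : ℝ} (h : LC f m σ) {p q x d κ : ℝ} (hpq : q < p)
    (hqx : x ≤ q)
    (hd : p - q ≤ d) (hp : 0 < f p) (hκ : 0 ≤ κ) (hq : f q ≤ f p * Real.exp (-κ)) :
    f x ≤ f p * Real.exp (-(κ / d) * |x - p|) := by
  have := h.reflect.decay (p := -p) (q := -q) (x := -x) (d := d) (κ := κ) (by linarith)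
    (by linarith) (by linarith) (by simpa using hp) hκ (by simpa using hq)
  simp only [neg_neg] at this
  rwa [show |(-x) - (-p)| = |x - p| by rw [← abs_neg]; congr 1; ring] at this

theorem sqexp {k : ℝ} (hk : 0 < k) (p : ℝ) :
    Integrable (fun x : ℝ => (x - p)^2 * Real.exp (-k * |x - p|)) ∧
    ∫ x : ℝ, (x - p)^2 * Real.exp (-k * |x - p|) = 4 / k^3 := by
  have hv : ∫ x in Ioi (0:ℝ), x^2 * Real.exp (-k * x) = 2 / k^3 := by
    have := Real.integral_rpow_mul_exp_neg_mul_Ioi (a := 3) (r := k) (by norm_num) hk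
    have hG : Real.Gamma 3 = 2 := by
      have := Real.Gamma_nat_eq_factorial 2
      rw [show ((2:ℕ):ℝ) + 1 = 3 by norm_num] at this
      rw [this]; norm_num [Nat.factorial]
    rw [hG] at this
    rw [show (2:ℝ) / k^3 = (1 / k) ^ (3:ℝ) * 2 by
      rw [show (3:ℝ) = ((3:ℕ):ℝ) by norm_num, Real.rpow_natCast]; field_simp]
    rw [← this]
    refine setIntegral_congr_fun measurableSet_Ioi ?_
    intro x hx
    simp only
    rw [show (3:ℝ) - 1 = ((2:ℕ):ℝ) by norm_num, Real.rpow_natCast]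
    congr 2; ring
  have hB : ∫ x : ℝ, x^2 * Real.exp (-k * |x|) = 4 / k^3 := by
    have := integral_comp_abs (f := fun x : ℝ => x^2 * Real.exp (-k * x))
    simp only [sq_abs] at this
    rw [this, hv]; ring
  have hA : Integrable (fun x : ℝ => x^2 * Real.exp (-k * |x|)) := by
    apply Integrable.of_integral_ne_zero
    rw [hB]; positivity
  refine ⟨hA.comp_sub_right p, ?_⟩
  rw [integral_sub_right_eq_self (fun x : ℝ => x^2 * Real.exp (-k * |x|)) p, hB]


theorem LC.moment {f : ℝ → ℝ} {m σ : ℝ} (h : LC f m σ) (y : ℝ) :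
    Integrable (fun x => (x - y)^2 * f x) ∧ σ^2 ≤ ∫ x, (x - y)^2 * f x := by
  have e : (fun x => (x - y)^2 * f x) =
      fun x => ((x - m)^2 * f x + (2 * (m - y)) * ((x - m) * f x)) + (m - y)^2 * f x := by
    ext x; ring
  have i1 := h.int1.const_mul (2 * (m - y))
  have i0 := h.int.const_mul ((m - y)^2)
  rw [e]
  have i2 : Integrable (fun x => (x - m)^2 * f x + (2 * (m - y)) * ((x - m) * f x)) :=
    h.int2.add i1
  refine ⟨i2.add i0, ?_⟩
  rw [integral_add i2 i0, integral_add h.int2 i1, integral_const_mul,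
    integral_const_mul, h.var, h.mean, h.one]
  nlinarith [sq_nonneg (m - y)]

theorem LC.setle {f : ℝ → ℝ} {m σ : ℝ} (h : LC f m σ) (s : Set ℝ) : ∫ x in s, f x ≤ 1 := by
  rw [← h.one]
  exact setIntegral_le_integral h.int (Filter.Eventually.of_forall h.nn)

theorem LC.drop {f : ℝ → ℝ} {m σ : ℝ} (h : LC f m σ) {p : ℝ} (hp : 0 < f p) :
    ∃ q, p < q ∧ q ≤ p + 3 / f p ∧ f q ≤ f p / 2 := by
  by_contra hc
  push Not at hc
  have hd : 0 < 3 / f p := by positivity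
  have h1 : ∫ x in Ioc p (p + 3 / f p), f p / 2 ≤ ∫ x in Ioc p (p + 3 / f p), f x := by
    refine setIntegral_mono_on (integrableOn_const (by simp)) h.int.integrableOn
      measurableSet_Ioc ?_
    intro x hx
    exact (hc x hx.1 hx.2).le
  have h2 := h.setle (Ioc p (p + 3 / f p))
  rw [setIntegral_const] at h1
  simp only [Measure.real, Real.volume_Ioc, add_sub_cancel_left, ENNReal.toReal_ofReal hd.le,
    smul_eq_mul] at h1
  have : 3 / f p * (f p / 2) = 3 / 2 := by field_simp
  linarith

theorem upper : ∃ K > (0:ℝ), ∀ (f : ℝ → ℝ) (m σ : ℝ), LC f m σ → ∀ p, f p ≤ K / σ := by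
  have hl : 0 < Real.log 2 := Real.log_pos (by norm_num)
  have hA : 0 < 1 + 12 / (Real.log 2)^3 := by positivity
  refine ⟨3 * √(1 + 12 / (Real.log 2)^3), by positivity, ?_⟩
  intro f m σ h p
  have hσ := h.pos
  rcases (h.nn p).eq_or_lt with h0 | hp
  · rw [← h0]; positivity
  obtain ⟨q, hq1, hq2, hq3⟩ := h.drop hp
  obtain ⟨q', hq1', hq2', hq3'⟩ := h.reflect.drop (p := -p) (by simpa using hp)
  simp only [neg_neg] at hq2' hq3'
  set d := 3 / f p with hd
  have hd0 : 0 < d := by positivity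
  have e2 : Real.exp (-Real.log 2) = 1 / 2 := by
    rw [Real.exp_neg, Real.exp_log (by norm_num)]; norm_num
  have key : ∀ x, (x - p)^2 * f x ≤ d^2 * f x +
      f p * ((x - p)^2 * Real.exp (-(Real.log 2 / d) * |x - p|)) := by
    intro x
    have hn := h.nn x
    by_cases hx : |x - p| ≤ d
    · have : (x - p)^2 ≤ d^2 := by rw [← sq_abs]; gcongr
      have : 0 ≤ f p * ((x - p)^2 * Real.exp (-(Real.log 2 / d) * |x - p|)) := by positivity
      nlinarith
    · push Not at hx
      have hdec : f x ≤ f p * Real.exp (-(Real.log 2 / d) * |x - p|) := by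
        rcases lt_abs.1 hx with h1 | h1
        · exact h.decay hq1 (by linarith) (by linarith) hp hl.le (by rw [e2]; linarith)
        · exact h.decay_left (q := -q') (by linarith) (by linarith) (by linarith) hp hl.le
            (by rw [e2]; linarith)
      have := mul_le_mul_of_nonneg_left hdec (sq_nonneg (x - p))
      nlinarith [mul_nonneg (sq_nonneg d) hn]
  have hk : 0 < Real.log 2 / d := by positivity
  obtain ⟨si, sv⟩ := sqexp hk p
  obtain ⟨mi, mv⟩ := h.moment p
  have i1 := h.int.const_mul (d^2)
  have i2 := si.const_mul (f p)
  have := integral_mono mi (i1.add i2) key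
  simp only [Pi.add_apply] at this
  rw [integral_add i1 i2, integral_const_mul, integral_const_mul, sv, h.one] at this
  have hfp : f p = 3 / d := by rw [hd]; field_simp
  have e3 : d^2 * 1 + f p * (4 / (Real.log 2 / d)^3) = (1 + 12 / (Real.log 2)^3) * d^2 := by
    rw [hfp]; field_simp; ring
  rw [e3] at this
  have h4 : σ ≤ √(1 + 12 / (Real.log 2)^3) * d := by
    refine (sq_le_sq₀ hσ.le (by positivity)).1 ?_
    rw [mul_pow, Real.sq_sqrt hA.le]; linarith
  rw [le_div_iff₀ hσ, hfp]
  rw [div_mul_eq_mul_div, div_le_iff₀ hd0]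
  nlinarith

theorem indc (a b C : ℝ) (hab : a ≤ b) : Integrable ((Icc a b).indicator (fun _ => C)) ∧
    ∫ x, (Icc a b).indicator (fun _ => C) x = (b - a) * C := by
  refine ⟨(integrable_indicator_iff measurableSet_Icc).2 (integrableOn_const (by simp)), ?_⟩
  rw [integral_indicator measurableSet_Icc, setIntegral_const]
  simp only [Measure.real, Real.volume_Icc, smul_eq_mul]
  rw [ENNReal.toReal_ofReal (by linarith)]

theorem LC.exists_high {f : ℝ → ℝ} {m σ : ℝ} (h : LC f m σ) : ∃ p, 1 / (8 * σ) ≤ f p := by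
  by_contra hc
  push Not at hc
  have hσ := h.pos
  have key : ∀ x, f x ≤ (1 / (4 * σ^2)) * ((x - m)^2 * f x) +
      (Icc (m - 2 * σ) (m + 2 * σ)).indicator (fun _ => 1 / (8 * σ)) x := by
    intro x
    have hn := h.nn x
    by_cases hx : x ∈ Icc (m - 2 * σ) (m + 2 * σ)
    · simp only [hx, indicator_of_mem]
      have : 0 ≤ (1 / (4 * σ^2)) * ((x - m)^2 * f x) := by positivity
      linarith [hc x]
    · simp only [hx, not_false_eq_true, indicator_of_notMem, add_zero]
      have h2 : (2 * σ)^2 ≤ (x - m)^2 := by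
        rw [← sq_abs (x - m)]
        have : 2 * σ ≤ |x - m| := by
          by_contra hcc
          push Not at hcc
          have := abs_lt.1 hcc
          exact hx ⟨by linarith, by linarith⟩
        gcongr
      have : 1 ≤ (1 / (4 * σ^2)) * (x - m)^2 := by
        rw [div_mul_eq_mul_div, le_div_iff₀ (by positivity)]; nlinarith
      nlinarith
  have i1 := h.int2.const_mul (1 / (4 * σ^2))
  obtain ⟨i2, v2⟩ := indc (m - 2 * σ) (m + 2 * σ) (1 / (8 * σ)) (by linarith)
  have := integral_mono h.int (i1.add i2) key
  simp only [Pi.add_apply] at this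
  rw [integral_add i1 i2, integral_const_mul, h.var, h.one, v2] at this
  have e1 : 1 / (4 * σ^2) * σ^2 = 1 / 4 := by field_simp
  have e2 : (m + 2 * σ - (m - 2 * σ)) * (1 / (8 * σ)) = 1 / 2 := by field_simp; ring
  linarith

set_option maxHeartbeats 1000000 in
theorem lower : ∃ c > (0:ℝ), ∀ (f : ℝ → ℝ) (m σ : ℝ), LC f m σ →
    ∃ a, ∀ x ∈ Icc a (a + σ), c / σ ≤ f x := by
  obtain ⟨K, hK, hup⟩ := upper
  set κ := 18 * K + 1 with hκ
  have hκ1 : 1 < κ := by linarith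
  set c := (1 / 18) * Real.exp (-κ) with hc
  have hc0 : 0 < c := by positivity
  have hc1 : c ≤ 1 / 18 := by
    have : Real.exp (-κ) ≤ 1 := Real.exp_le_one_iff.2 (by linarith)
    linarith
  refine ⟨c, hc0, ?_⟩
  intro f m σ h
  have hσ := h.pos
  obtain ⟨p, hp⟩ := h.exists_high
  have hp0 : 0 < f p := lt_of_lt_of_le (by positivity) hp
  have hcp : c / σ ≤ f p * Real.exp (-κ) := by
    have e : c / σ = (1 / (18 * σ)) * Real.exp (-κ) := by rw [hc]; field_simp
    rw [e]
    gcongr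
    refine le_trans ?_ hp
    gcongr
    norm_num
  have hpL : c / σ ≤ f p := by
    refine le_trans hcp ?_
    have : Real.exp (-κ) ≤ 1 := Real.exp_le_one_iff.2 (by linarith)
    nlinarith
  by_contra hno
  push Not at hno
  set L : Set ℝ := {x | c / σ ≤ f x} with hL
  have hdiam : ∀ a ∈ L, ∀ b ∈ L, b < a + σ := by
    intro a ha b hb
    by_contra hcc
    push Not at hcc
    obtain ⟨x, hx, hx2⟩ := hno a
    have := h.quasi hx.1 (le_trans hx.2 hcc)
    exact absurd hx2 (not_lt.2 (le_trans (le_min ha hb) this))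
  have hpm : p ∈ L := hpL
  have hba : BddAbove L := ⟨p + σ, fun b hb => (hdiam p hpm b hb).le⟩
  have hbb : BddBelow L := ⟨p - σ, fun b hb => by linarith [hdiam b hb p hpm]⟩
  set b0 := sSup L with hb0
  set a0 := sInf L with ha0
  have hab : b0 ≤ a0 + σ := by
    apply csSup_le ⟨p, hpm⟩
    intro b hb
    have : b - σ ≤ a0 := le_csInf ⟨p, hpm⟩ (fun a ha => by linarith [hdiam a ha b hb])
    linarith
  have hin : ∀ x ∈ L, a0 ≤ x ∧ x ≤ b0 := fun x hx => ⟨csInf_le hbb hx, le_csSup hba hx⟩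
  set y := (a0 + b0) / 2 with hy
  have hpy : |p - y| ≤ σ / 2 := by
    rw [abs_le]; have := hin p hpm; constructor <;> linarith
  have hup' := hup f m σ h p
  have hR : f (p + σ) ≤ f p * Real.exp (-κ) := by
    by_contra hcc
    push Not at hcc
    exact lt_irrefl _ (hdiam p hpm (p + σ) (le_trans hcp hcc.le))
  have hLft : f (p - σ) ≤ f p * Real.exp (-κ) := by
    by_contra hcc
    push Not at hcc
    have := hdiam (p - σ) (le_trans hcp hcc.le) p hpm
    linarith
  have key : ∀ x, (x - y)^2 * f x ≤ (σ^2 / 4) * f x +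
      (Icc (p - σ) (p + σ)).indicator (fun _ => (9 / 4) * σ * c) x +
      ((9 / 4) * (K / σ)) * ((x - p)^2 * Real.exp (-(κ / σ) * |x - p|)) := by
    intro x
    have hn := h.nn x
    have n1 : 0 ≤ (σ^2 / 4) * f x := by positivity
    have n2 : 0 ≤ (Icc (p - σ) (p + σ)).indicator (fun _ => (9 / 4) * σ * c) x :=
      indicator_nonneg (fun _ _ => by positivity) x
    have n3 : 0 ≤ ((9 / 4) * (K / σ)) * ((x - p)^2 * Real.exp (-(κ / σ) * |x - p|)) := by
      positivity
    by_cases hx : x ∈ L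
    · have hh := hin x hx
      have : (x - y)^2 ≤ σ^2 / 4 := by
        have : |x - y| ≤ σ / 2 := by rw [abs_le]; constructor <;> linarith
        rw [← sq_abs]
        have := pow_le_pow_left₀ (abs_nonneg _) this 2
        nlinarith
      nlinarith
    · have hx : f x < c / σ := by simpa [hL] using hx
      have tri : |x - y| ≤ |x - p| + σ / 2 := by
        have := abs_add_le (x - p) (p - y)
        rw [sub_add_sub_cancel] at this
        linarith
      by_cases hxp : |x - p| ≤ σ
      · have hxI : x ∈ Icc (p - σ) (p + σ) := by
          have := abs_le.1 hxp
          exact ⟨by linarith, by linarith⟩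
        simp only [hxI, indicator_of_mem] at n2 ⊢
        have h1 : (x - y)^2 ≤ (9 / 4) * σ^2 := by
          rw [← sq_abs]
          have := pow_le_pow_left₀ (abs_nonneg _) (show |x - y| ≤ 3 / 2 * σ by linarith) 2
          nlinarith
        have h2 : (x - y)^2 * f x ≤ (9 / 4) * σ^2 * (c / σ) := by
          gcongr
        have e : (9 / 4) * σ^2 * (c / σ) = (9 / 4) * σ * c := by field_simp
        linarith
      · push Not at hxp
        have hdec : f x ≤ f p * Real.exp (-(κ / σ) * |x - p|) := by
          rcases lt_abs.1 hxp with h1 | h1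
          · exact h.decay (q := p + σ) (by linarith) (by linarith) (by linarith) hp0 (by linarith) hR
          · exact h.decay_left (q := p - σ) (by linarith) (by linarith) (by linarith) hp0
              (by linarith) hLft
        have h1 : (x - y)^2 ≤ (9 / 4) * (x - p)^2 := by
          rw [← sq_abs, ← sq_abs (x - p)]
          have := pow_le_pow_left₀ (abs_nonneg _) (show |x - y| ≤ 3 / 2 * |x - p| by linarith) 2
          nlinarith
        have h2 : (x - y)^2 * f x ≤ (9 / 4) * (x - p)^2 *
            ((K / σ) * Real.exp (-(κ / σ) * |x - p|)) := by
          gcongr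
          refine le_trans hdec ?_
          gcongr
        nlinarith
  have hk : 0 < κ / σ := by positivity
  obtain ⟨si, sv⟩ := sqexp hk p
  obtain ⟨mi, mv⟩ := h.moment y
  have i1 := h.int.const_mul (σ^2 / 4)
  obtain ⟨i2, v2⟩ := indc (p - σ) (p + σ) ((9 / 4) * σ * c) (by linarith)
  have i3 := si.const_mul ((9 / 4) * (K / σ))
  have i12 : Integrable (fun x => (σ^2 / 4) * f x +
      (Icc (p - σ) (p + σ)).indicator (fun _ => (9 / 4) * σ * c) x) := i1.add i2
  have := integral_mono mi (i12.add i3) key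
  simp only [Pi.add_apply] at this
  rw [integral_add i12 i3, integral_add i1 i2, integral_const_mul, integral_const_mul, sv, h.one, v2] at this
  have e3 : 9 / 4 * (K / σ) * (4 / (κ / σ)^3) = (9 * K / κ^3) * σ^2 := by
    field_simp
  have e4 : 9 * K / κ^3 < 1 / 2 := by
    rw [div_lt_iff₀ (by positivity)]
    have : κ ≤ κ^3 := by nlinarith [sq_nonneg κ, mul_pos (sub_pos.2 hκ1) (sub_pos.2 hκ1)]
    nlinarith
  have s2 : 0 < σ^2 := by positivity
  rw [e3] at this
  nlinarith


theorem expM_integral (g : ℝ → ℝ) :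
    ∫ x, g x ∂(ProbabilityTheory.expMeasure 1) = ∫ x in Ioi (0:ℝ), Real.exp (-x) * g x := by
  have hm : Measurable (ProbabilityTheory.gammaPDF 1 1) :=
    (ProbabilityTheory.measurable_gammaPDFReal 1 1).ennreal_ofReal
  rw [ProbabilityTheory.expMeasure, ProbabilityTheory.gammaMeasure,
    integral_withDensity_eq_integral_toReal_smul₀ hm.aemeasurable
      (Filter.Eventually.of_forall fun x => by simp [ProbabilityTheory.gammaPDF]),
    ← integral_Ici_eq_integral_Ioi, ← integral_indicator measurableSet_Ici]
  congr 1
  ext x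
  by_cases hx : 0 ≤ x
  · rw [indicator_of_mem (show x ∈ Ici 0 from hx), ProbabilityTheory.gammaPDF_of_nonneg hx]
    rw [ENNReal.toReal_ofReal (by simp; positivity)]
    simp
  · rw [indicator_of_notMem (by simpa using hx), ProbabilityTheory.gammaPDF_of_neg (by linarith)]
    simp

theorem expM_one : ∫ x, x ∂(ProbabilityTheory.expMeasure 1) = 1 := by
  rw [expM_integral]
  have := Real.Gamma_eq_integral (s := 2) (by norm_num)
  rw [Real.Gamma_two] at this
  rw [this]
  refine setIntegral_congr_fun measurableSet_Ioi ?_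
  intro x hx
  norm_num

theorem expM_two : ∫ x, x^2 ∂(ProbabilityTheory.expMeasure 1) = 2 := by
  rw [expM_integral]
  have := Real.Gamma_eq_integral (s := 3) (by norm_num)
  have hG : Real.Gamma 3 = 2 := by
    have := Real.Gamma_nat_eq_factorial 2
    rw [show ((2:ℕ):ℝ) + 1 = 3 by norm_num] at this
    rw [this]; norm_num [Nat.factorial]
  rw [hG] at this
  rw [this]
  refine setIntegral_congr_fun measurableSet_Ioi ?_
  intro x hx
  norm_num

theorem deriv_aux (a b c x : ℝ) :
    HasDerivAt (fun v => -((a * v^2 + b * v + c) * Real.exp (-v)))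
      (Real.exp (-x) * (a * x^2 + (b - 2 * a) * x + (c - b))) x := by
  have h1 : HasDerivAt (fun v : ℝ => a * v^2 + b * v + c) (a * (2 * x) + b) x := by
    have := (((hasDerivAt_pow 2 x).const_mul a).add ((hasDerivAt_id x).const_mul b)).add_const c
    exact this.congr_deriv (by norm_num)
  have h2 : HasDerivAt (fun v : ℝ => Real.exp (-v)) (Real.exp (-x) * (-1)) x :=
    (hasDerivAt_id x).neg.exp
  exact (h1.mul h2).neg.congr_deriv (by ring)

theorem expM_min {u : ℝ} (hu : 0 < u) :
    ∫ x, (min x u) * ((u + 1) * x - u) ∂(ProbabilityTheory.expMeasure 1)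
      = u + 2 - Real.exp (-u) * (u^2 + 2 * u + 2) := by
  rw [expM_integral]
  have hI : ∀ a b c : ℝ, IntegrableOn (fun x => Real.exp (-x) * (a * x^2 + b * x + c)) (Ioi 0) := by
    intro a b c
    have h3 := Real.GammaIntegral_convergent (s := 3) (by norm_num)
    have h2 := Real.GammaIntegral_convergent (s := 2) (by norm_num)
    have h1 := Real.GammaIntegral_convergent (s := 1) (by norm_num)
    have : IntegrableOn (fun x => a * (Real.exp (-x) * x ^ ((3:ℝ) - 1)) +
        b * (Real.exp (-x) * x ^ ((2:ℝ) - 1)) + c * (Real.exp (-x) * x ^ ((1:ℝ) - 1))) (Ioi 0) :=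
      ((h3.const_mul a).add (h2.const_mul b)).add (h1.const_mul c)
    refine this.congr_fun ?_ measurableSet_Ioi
    intro x hx
    norm_num
    try ring
  have hsub : Ioi u ⊆ Ioi 0 := Ioi_subset_Ioi hu.le
  have A : EqOn (fun x => Real.exp (-x) * ((u + 1) * x^2 + (u + 2 - 2 * (u + 1)) * x + (u + 2 - (u + 2))))
      (fun x => Real.exp (-x) * (min x u * ((u + 1) * x - u))) (Ioc 0 u) := by
    intro x hx
    simp only [min_eq_left hx.2]; ring
  have B : EqOn (fun x => Real.exp (-x) * (0 * x^2 + (u * (u + 1) - 2 * 0) * x + (u - u * (u + 1))))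
      (fun x => Real.exp (-x) * (min x u * ((u + 1) * x - u))) (Ioi u) := by
    intro x hx
    simp only [min_eq_right (le_of_lt (show u < x from hx))]; ring
  have iA := ((hI (u + 1) (u + 2 - 2 * (u + 1)) (u + 2 - (u + 2))).mono_set
    (Ioc_subset_Ioi_self : Ioc 0 u ⊆ Ioi 0)).congr_fun A measurableSet_Ioc
  have iB' := (hI 0 (u * (u + 1) - 2 * 0) (u - u * (u + 1))).mono_set hsub
  have iB := iB'.congr_fun B measurableSet_Ioi
  rw [← Ioc_union_Ioi_eq_Ioi hu.le, setIntegral_union (Ioc_disjoint_Ioi le_rfl) measurableSet_Ioi iA iB,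
    ← setIntegral_congr_fun measurableSet_Ioc A, ← setIntegral_congr_fun measurableSet_Ioi B,
    ← intervalIntegral.integral_of_le hu.le]
  rw [intervalIntegral.integral_eq_sub_of_hasDerivAt (fun x _ => deriv_aux (u + 1) (u + 2) (u + 2) x)
    (by apply Continuous.intervalIntegrable; fun_prop)]
  have hT : Filter.Tendsto (fun v => -((0 * v^2 + (u * (u + 1)) * v + u) * Real.exp (-v)))
      Filter.atTop (nhds 0) := by
    have t1 := (Real.tendsto_pow_mul_exp_neg_atTop_nhds_zero 1).const_mul (u * (u + 1))
    have t0 := (Real.tendsto_pow_mul_exp_neg_atTop_nhds_zero 0).const_mul u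
    have := (t1.add t0).neg
    simp only [mul_zero, add_zero, neg_zero] at this
    refine this.congr ?_
    intro x; ring
  rw [integral_Ioi_of_hasDerivAt_of_tendsto' (fun x _ => deriv_aux 0 (u * (u + 1)) u x) iB' hT]
  simp
  ring

theorem expM_min_ge {u : ℝ} (hu : 0 < u) :
    u ≤ ∫ x, (min x u) * ((u + 1) * x - u) ∂(ProbabilityTheory.expMeasure 1) := by
  rw [expM_min hu]
  have h1 := Real.quadratic_le_exp_of_nonneg hu.le
  have h2 : Real.exp (-u) * Real.exp u = 1 := by rw [← Real.exp_add]; simp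
  nlinarith [Real.exp_pos (-u)]


/-- tail function -/
noncomputable def tl (f : ℝ → ℝ) (x : ℝ) : ℝ := ∫ y in Ioi x, f y

theorem LC.tl_eq {f : ℝ → ℝ} {m σ : ℝ} (h : LC f m σ) (x : ℝ) :
    tl f x = tl f 0 - ∫ y in (0:ℝ)..x, f y := by
  have := intervalIntegral.integral_interval_add_Ioi (a := 0) (b := x) h.int.integrableOn
    h.int.integrableOn
  unfold tl; linarith

theorem LC.tl_compl {f : ℝ → ℝ} {m σ : ℝ} (h : LC f m σ) (x : ℝ) :
    tl f x = 1 - ∫ y in Iic x, f y := by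
  have := intervalIntegral.integral_Iic_add_Ioi (b := x) h.int.integrableOn h.int.integrableOn
  unfold tl; linarith [h.one]

theorem LC.tl_cont {f : ℝ → ℝ} {m σ : ℝ} (h : LC f m σ) : Continuous (tl f) := by
  have : tl f = fun x => tl f 0 - ∫ y in (0:ℝ)..x, f y := by ext x; exact h.tl_eq x
  rw [this]
  exact continuous_const.sub (intervalIntegral.continuous_primitive
    (fun a b => h.int.intervalIntegrable) 0)

theorem LC.tl_le {f : ℝ → ℝ} {m σ : ℝ} (h : LC f m σ) (x : ℝ) : tl f x ≤ 1 := h.setle _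

theorem LC.tl_nn {f : ℝ → ℝ} {m σ : ℝ} (h : LC f m σ) (x : ℝ) : 0 ≤ tl f x :=
  integral_nonneg h.nn

theorem LC.tl_surj {f : ℝ → ℝ} {m σ : ℝ} (h : LC f m σ) {v : ℝ} (h0 : 0 < v) (h1 : v < 1) :
    ∃ x, tl f x = v := by
  have t1 : Filter.Tendsto (tl f) Filter.atTop (nhds 0) := by
    have := intervalIntegral_tendsto_integral_Ioi 0 h.int.integrableOn Filter.tendsto_id
    have := this.const_sub (tl f 0)
    rw [show tl f 0 - ∫ y in Ioi 0, f y = 0 from sub_self _] at this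
    exact this.congr (fun x => (h.tl_eq x).symm)
  have t2 : Filter.Tendsto (tl f) Filter.atBot (nhds 1) := by
    have := intervalIntegral_tendsto_integral_Iic 0 h.int.integrableOn Filter.tendsto_id
    have := this.const_add (tl f 0)
    rw [show tl f 0 + ∫ y in Iic 0, f y = 1 by linarith [h.tl_compl 0]] at this
    refine this.congr (fun x => ?_)
    rw [h.tl_eq x, intervalIntegral.integral_symm]; simp [sub_eq_add_neg]
  obtain ⟨a, ha⟩ := (t1.eventually (gt_mem_nhds h0)).exists
  obtain ⟨b, hb⟩ := (t2.eventually (lt_mem_nhds h1)).exists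
  exact mem_range_of_exists_le_of_exists_ge h.tl_cont ⟨a, ha.le⟩ ⟨b, hb.le⟩

theorem LC.tl_deriv {f : ℝ → ℝ} {m σ : ℝ} (h : LC f m σ) {x : ℝ}
    (hx : x ∈ interior {x | 0 < f x}) : HasDerivAt (tl f) (- f x) x := by
  have hc := (lc_aem h.nn h.conv h.conc).1
  have : tl f = fun x => tl f 0 - ∫ y in (0:ℝ)..x, f y := by ext x; exact h.tl_eq x
  rw [this]
  have h1 := intervalIntegral.integral_hasDerivAt_right (a := 0) (b := x) (f := f)
    h.int.intervalIntegrable (h.int.aestronglyMeasurable.stronglyMeasurableAtFilter)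
    (hc.continuousAt (isOpen_interior.mem_nhds hx))
  exact h1.const_sub _

theorem LC.J_conv {f : ℝ → ℝ} {m σ : ℝ} (h : LC f m σ) :
    Convex ℝ (interior {x | 0 < f x}) := h.conv.interior

theorem LC.J_pos {f : ℝ → ℝ} {m σ : ℝ} (_h : LC f m σ) {x : ℝ}
    (hx : x ∈ interior {x | 0 < f x}) : 0 < f x := by
  have : x ∈ {x | 0 < f x} := interior_subset hx
  exact this

theorem LC.tl_anti {f : ℝ → ℝ} {m σ : ℝ} (h : LC f m σ) :
    StrictAntiOn (tl f) (interior {x | 0 < f x}) := by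
  apply strictAntiOn_of_deriv_neg h.J_conv h.tl_cont.continuousOn
  intro x hx
  rw [interior_interior] at hx
  rw [(h.tl_deriv hx).deriv]
  linarith [h.J_pos hx]

theorem LC.tl_pos {f : ℝ → ℝ} {m σ : ℝ} (h : LC f m σ) {x : ℝ}
    (hx : x ∈ interior {x | 0 < f x}) : 0 < tl f x ∧ tl f x < 1 := by
  obtain ⟨ε, hε, hb⟩ := Metric.isOpen_iff.1 isOpen_interior x hx
  have m1 : x + ε / 2 ∈ interior {x | 0 < f x} := by
    apply hb; rw [Metric.mem_ball, Real.dist_eq]; simp; rw [abs_of_pos (by linarith)]; linarith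
  have m2 : x - ε / 2 ∈ interior {x | 0 < f x} := by
    apply hb; rw [Metric.mem_ball, Real.dist_eq]; simp; rw [abs_of_pos (by linarith)]; linarith
  have a1 := h.tl_anti hx m1 (by linarith)
  have a2 := h.tl_anti m2 hx (by linarith)
  exact ⟨lt_of_le_of_lt (h.tl_nn _) a1, lt_of_lt_of_le a2 (h.tl_le _)⟩

theorem LC.J_cases {f : ℝ → ℝ} {m σ : ℝ} (h : LC f m σ) {y : ℝ}
    (hy : y ∉ interior {x | 0 < f x}) : tl f y = 0 ∨ (tl f y = 1 ∧ ∀ᵐ x, f x = 0 ∨ y ≤ x) := by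
  have hz := (lc_aem h.nn h.conv h.conc).2.1
  have ho := h.J_conv.ordConnected
  by_cases hc : ∃ x ∈ interior {x | 0 < f x}, y < x
  · right
    obtain ⟨x1, hx1, hyx1⟩ := hc
    have hall : ∀ x ∈ interior {x | 0 < f x}, y < x := by
      intro x hx
      by_contra hcc
      push Not at hcc
      exact hy (ho.out hx hx1 ⟨hcc, hyx1.le⟩)
    have hae : ∀ᵐ x, f x = 0 ∨ y < x := by
      filter_upwards [hz] with x hx
      by_cases hxi : x ∈ interior {x | 0 < f x}
      · exact Or.inr (hall x hxi)
      · exact Or.inl (hx hxi)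
    refine ⟨?_, hae.mono fun x hx => hx.imp id le_of_lt⟩
    rw [h.tl_compl, setIntegral_eq_zero_of_ae_eq_zero, sub_zero]
    filter_upwards [hae] with x hx hxy
    rcases hx with hx | hx
    · exact hx
    · exact absurd hx (not_lt.2 hxy)
  · left
    push Not at hc
    unfold tl
    rw [setIntegral_eq_zero_of_ae_eq_zero]
    filter_upwards [hz] with x hx hxy
    apply hx
    intro hxi
    exact absurd (hc x hxi) (not_le.2 hxy)

theorem LC.tl_shift (f : ℝ → ℝ) (y : ℝ) : tl f y = ∫ s in Ioi (0:ℝ), f (y + s) := by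
  have := (measurePreserving_add_left (volume : Measure ℝ) y).setIntegral_preimage_emb
    (measurableEmbedding_addLeft y) f (Ioi y)
  rw [tl, ← this]
  simp

theorem LC.hazard {f : ℝ → ℝ} {m σ : ℝ} (h : LC f m σ) {x y : ℝ} (hxy : x ≤ y) :
    f x * tl f y ≤ f y * tl f x := by
  rw [LC.tl_shift f y, LC.tl_shift f x, ← integral_const_mul, ← integral_const_mul]
  refine setIntegral_mono_on ((h.int.comp_add_left y).integrableOn.const_mul _)
    ((h.int.comp_add_left x).integrableOn.const_mul _) measurableSet_Ioi ?_
  intro s hs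
  exact h.pair hxy (le_of_lt (show 0 < s from hs))

/-- cumulative hazard -/
noncomputable def hz (f : ℝ → ℝ) (x : ℝ) : ℝ := - Real.log (tl f x)

theorem LC.hz_deriv {f : ℝ → ℝ} {m σ : ℝ} (h : LC f m σ) {x : ℝ}
    (hx : x ∈ interior {x | 0 < f x}) : HasDerivAt (hz f) (f x / tl f x) x := by
  have := ((h.tl_deriv hx).log (h.tl_pos hx).1.ne').neg
  exact this.congr_deriv (by ring)

theorem LC.hz_convex {f : ℝ → ℝ} {m σ : ℝ} (h : LC f m σ) :
    ConvexOn ℝ (interior {x | 0 < f x}) (hz f) := by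
  apply MonotoneOn.convexOn_of_deriv h.J_conv
  · intro x hx
    exact (h.hz_deriv hx).continuousAt.continuousWithinAt
  · rw [interior_interior]
    intro x hx
    exact (h.hz_deriv hx).differentiableAt.differentiableWithinAt
  · rw [interior_interior]
    intro x hx y hy hxy
    rw [(h.hz_deriv hx).deriv, (h.hz_deriv hy).deriv, div_le_div_iff₀ (h.tl_pos hx).1 (h.tl_pos hy).1]
    exact h.hazard hxy

theorem LC.hz_mono {f : ℝ → ℝ} {m σ : ℝ} (h : LC f m σ) :
    StrictMonoOn (hz f) (interior {x | 0 < f x}) := by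
  intro x hx y hy hxy
  have := Real.log_lt_log (h.tl_pos hy).1 (h.tl_anti hx hy hxy)
  unfold hz; linarith

theorem LC.hz_nn {f : ℝ → ℝ} {m σ : ℝ} (h : LC f m σ) (x : ℝ) : 0 ≤ hz f x := by
  have := Real.log_nonpos (h.tl_nn x) (h.tl_le x)
  unfold hz; linarith

theorem LC.hz_pos {f : ℝ → ℝ} {m σ : ℝ} (h : LC f m σ) {x : ℝ}
    (hx : x ∈ interior {x | 0 < f x}) : 0 < hz f x := by
  have := Real.log_neg (h.tl_pos hx).1 (h.tl_pos hx).2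
  unfold hz; linarith

theorem LC.hz_surj {f : ℝ → ℝ} {m σ : ℝ} (h : LC f m σ) {v : ℝ} (hv : 0 < v) :
    ∃ x ∈ interior {x | 0 < f x}, hz f x = v ∧ tl f x = Real.exp (-v) := by
  have h1 : Real.exp (-v) < 1 := by rw [← Real.exp_zero]; exact Real.exp_lt_exp.2 (by linarith)
  have h0 := Real.exp_pos (-v)
  obtain ⟨x, hx⟩ := h.tl_surj h0 h1
  refine ⟨x, ?_, ?_, hx⟩
  · by_contra hc
    rcases h.J_cases hc with h2 | h2
    · linarith
    · linarith [h2.1]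
  · unfold hz; rw [hx, Real.log_exp]; ring

/-- the measure -/
noncomputable def ms (f : ℝ → ℝ) : Measure ℝ := volume.withDensity (fun x => ENNReal.ofReal (f x))

theorem LC.aem {f : ℝ → ℝ} {m σ : ℝ} (h : LC f m σ) :
    AEMeasurable (fun x => ENNReal.ofReal (f x)) := h.int.aemeasurable.ennreal_ofReal

theorem LC.ms_int {f : ℝ → ℝ} {m σ : ℝ} (h : LC f m σ) (g : ℝ → ℝ) :
    ∫ x, g x ∂(ms f) = ∫ x, g x * f x := by
  rw [ms, integral_withDensity_eq_integral_toReal_smul₀ h.aem (by simp)]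
  congr 1; ext x
  rw [ENNReal.toReal_ofReal (h.nn x), smul_eq_mul, mul_comm]

theorem LC.ms_integrable {f : ℝ → ℝ} {m σ : ℝ} (h : LC f m σ) (g : ℝ → ℝ) :
    Integrable g (ms f) ↔ Integrable (fun x => g x * f x) := by
  rw [ms, integrable_withDensity_iff_integrable_smul₀' h.aem (by simp)]
  have : (fun x => (ENNReal.ofReal (f x)).toReal • g x) = fun x => g x * f x := by
    ext x
    rw [ENNReal.toReal_ofReal (h.nn x), smul_eq_mul, mul_comm]
  rw [this]

theorem LC.ms_set {f : ℝ → ℝ} {m σ : ℝ} (h : LC f m σ) {s : Set ℝ} (hs : MeasurableSet s) :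
    (ms f) s = ENNReal.ofReal (∫ x in s, f x) := by
  rw [ms, withDensity_apply _ hs, ofReal_integral_eq_lintegral_ofReal h.int.integrableOn
    (Filter.Eventually.of_forall h.nn)]

theorem LC.ms_prob {f : ℝ → ℝ} {m σ : ℝ} (h : LC f m σ) : IsProbabilityMeasure (ms f) := by
  constructor
  rw [h.ms_set MeasurableSet.univ, setIntegral_univ, h.one, ENNReal.ofReal_one]

theorem LC.ms_J {f : ℝ → ℝ} {m σ : ℝ} (h : LC f m σ) :
    ∀ᵐ x ∂(ms f), x ∈ interior {x | 0 < f x} := by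
  rw [ms, ae_withDensity_iff' h.aem]
  filter_upwards [(lc_aem h.nn h.conv h.conc).2.1] with x hx hne
  by_contra hc
  apply hne
  rw [hx hc, ENNReal.ofReal_zero]

theorem LC.hz_meas {f : ℝ → ℝ} {m σ : ℝ} (h : LC f m σ) : Measurable (hz f) :=
  (Real.measurable_log.comp h.tl_cont.measurable).neg

theorem LC.law {f : ℝ → ℝ} {m σ : ℝ} (h : LC f m σ) :
    (ms f).map (hz f) = ProbabilityTheory.expMeasure 1 := by
  have := h.ms_prob
  have := ProbabilityTheory.isProbabilityMeasure_expMeasure one_pos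
  have : IsProbabilityMeasure ((ms f).map (hz f)) :=
    Measure.isProbabilityMeasure_map h.hz_meas.aemeasurable
  apply Measure.eq_of_cdf
  ext v
  rw [ProbabilityTheory.cdf_expMeasure_eq one_pos, ProbabilityTheory.cdf_eq_real, Measure.real,
    Measure.map_apply h.hz_meas measurableSet_Iic]
  by_cases hv : 0 < v
  · obtain ⟨y, hy, hy1, hy2⟩ := h.hz_surj hv
    have : (ms f) (hz f ⁻¹' Iic v) = (ms f) (Iic y) := by
      apply measure_congr
      filter_upwards [h.ms_J] with x hx
      apply propext
      change hz f x ≤ v ↔ x ≤ y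
      rw [← hy1]
      exact h.hz_mono.le_iff_le hx hy
    rw [this, h.ms_set measurableSet_Iic, ENNReal.toReal_ofReal (integral_nonneg h.nn), if_pos hv.le]
    have := h.tl_compl y
    rw [hy2] at this
    rw [one_mul]; linarith
  · have : (ms f) (hz f ⁻¹' Iic v) = 0 := by
      rw [measure_eq_zero_iff_ae_notMem]
      filter_upwards [h.ms_J] with x hx hxx
      have : hz f x ≤ v := hxx
      linarith [h.hz_pos hx]
    rw [this]
    by_cases hv0 : 0 ≤ v
    · have : v = 0 := by linarith
      simp [this]
    · simp [hv0]


theorem LC.hz_map {f : ℝ → ℝ} {m σ : ℝ} (h : LC f m σ) {g : ℝ → ℝ} (hg : Measurable g) :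
    ∫ x, g (hz f x) ∂(ms f) = ∫ v, g v ∂(ProbabilityTheory.expMeasure 1) := by
  rw [← h.law, integral_map h.hz_meas.aemeasurable hg.aestronglyMeasurable]

theorem LC.cov {f : ℝ → ℝ} {m σ : ℝ} (h : LC f m σ) :
    Integrable (hz f) (ms f) ∧ ∫ x, hz f x ∂(ms f) = 1 ∧
    Integrable (fun x => x - m) (ms f) ∧ ∫ x, (x - m) ∂(ms f) = 0 ∧
    Integrable (fun x => (x - m) * hz f x) (ms f) ∧ ∫ x, (x - m) * hz f x ∂(ms f) ≤ σ ∧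
    Integrable (fun x => hz f x ^ 2) (ms f) := by
  have := h.ms_prob
  have hσ := h.pos
  have e1 : ∫ x, hz f x ∂(ms f) = 1 := by
    rw [h.hz_map (g := fun v => v) measurable_id, expM_one]
  have e2 : ∫ x, hz f x ^ 2 ∂(ms f) = 2 := by
    rw [h.hz_map (g := fun v => v^2) (by fun_prop), expM_two]
  have i1 : Integrable (hz f) (ms f) := by
    apply Integrable.of_integral_ne_zero; rw [e1]; norm_num
  have i2 : Integrable (fun x => hz f x ^ 2) (ms f) := by
    apply Integrable.of_integral_ne_zero; rw [e2]; norm_num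
  have j1 : Integrable (fun x => x - m) (ms f) := (h.ms_integrable _).2 h.int1
  have j2 : Integrable (fun x => (x - m)^2) (ms f) := (h.ms_integrable _).2 h.int2
  have d1 : ∫ x, (x - m) ∂(ms f) = 0 := by rw [h.ms_int]; exact h.mean
  have d2 : ∫ x, (x - m)^2 ∂(ms f) = σ^2 := by rw [h.ms_int]; exact h.var
  have k : Integrable (fun x => (x - m) * hz f x) (ms f) := by
    have a1 : MemLp (fun x => x - m) 2 (ms f) := (memLp_two_iff_integrable_sq j1.1).2 j2
    have a2 : MemLp (hz f) 2 (ms f) := (memLp_two_iff_integrable_sq i1.1).2 i2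
    exact a1.integrable_mul a2
  refine ⟨i1, e1, j1, d1, k, ?_, i2⟩
  -- arithmetic-geometric mean
  have key : ∀ x, (x - m) * hz f x ≤ ((1 / (2 * σ)) * (x - m)^2 + (x - m)) +
      ((σ / 2) * hz f x ^ 2 + ((-σ) * hz f x + σ / 2)) := by
    intro x
    have e : ((1 / (2 * σ)) * (x - m)^2 + (x - m)) +
      ((σ / 2) * hz f x ^ 2 + ((-σ) * hz f x + σ / 2)) - (x - m) * hz f x
      = (1 / (2 * σ)) * ((x - m) - σ * (hz f x - 1))^2 := by
      field_simp; ring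
    have : 0 ≤ (1 / (2 * σ)) * ((x - m) - σ * (hz f x - 1))^2 := by positivity
    linarith
  have A1 : Integrable (fun x => (1 / (2 * σ)) * (x - m)^2) (ms f) := j2.const_mul _
  have A2 : Integrable (fun x => (σ / 2) * hz f x ^ 2) (ms f) := i2.const_mul _
  have A3 : Integrable (fun x => (-σ) * hz f x) (ms f) := i1.const_mul _
  have A4 : Integrable (fun _ : ℝ => σ / 2) (ms f) := integrable_const _
  have B1 : Integrable (fun x => (1 / (2 * σ)) * (x - m)^2 + (x - m)) (ms f) := A1.add j1
  have B2 : Integrable (fun x => (-σ) * hz f x + σ / 2) (ms f) := A3.add A4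
  have B3 : Integrable (fun x => (σ / 2) * hz f x ^ 2 + ((-σ) * hz f x + σ / 2)) (ms f) := A2.add B2
  have := integral_mono k (B1.add B3) key
  simp only [Pi.add_apply] at this
  rw [integral_add B1 B3, integral_add A1 j1, integral_add A2 B2, integral_add A3 A4,
    integral_const_mul, integral_const_mul, integral_const_mul, integral_const, d1, d2, e1, e2] at this
  simp only [probReal_univ, smul_eq_mul] at this
  have e : 1 / (2 * σ) * σ^2 = σ / 2 := by field_simp
  linarith

theorem LC.tail_J {f : ℝ → ℝ} {m σ : ℝ} (h : LC f m σ) {t : ℝ}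
    (ht : t ∈ interior {x | 0 < f x}) : t - m ≤ (hz f t + 1) * σ := by
  have := h.ms_prob
  obtain ⟨i1, e1, j1, d1, k, kv, i2⟩ := h.cov
  set u := hz f t with hu
  have hu0 : 0 < u := h.hz_pos ht
  set a := u / (u + 1) with ha
  have ha0 : 0 < a := by positivity
  have hau : (u + 1) * a = u := by rw [ha]; field_simp
  have hlt : a < u := by nlinarith
  obtain ⟨y, hy, hya, -⟩ := h.hz_surj ha0
  have hyt : y < t := by
    rw [← h.hz_mono.lt_iff_lt hy ht, hya]; exact hlt
  set β := (t - y) / (u - a) with hβ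
  have hua : 0 < u - a := by linarith
  have hβ0 : 0 < β := div_pos (by linarith) hua
  have hβe : β * (u - a) = t - y := by rw [hβ]; field_simp
  have cvx := h.hz_convex
  have key : ∀ᵐ x ∂(ms f), (y - m - β * a) * ((u + 1) * hz f x - u) +
      β * (min (hz f x) u * ((u + 1) * hz f x - u)) ≤
      (u + 1) * ((x - m) * hz f x) - u * (x - m) := by
    filter_upwards [h.ms_J] with x hx
    suffices hs : 0 ≤ ((x - y) - β * (min (hz f x) u - a)) * ((u + 1) * hz f x - u) by nlinarith
    rcases lt_trichotomy x y with hxy | hxy | hxy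
    · have h1 := h.hz_mono hx hy hxy
      rw [hya] at h1
      have sl := cvx.slope_mono_adjacent hx ht hxy hyt
      rw [hya, ← hu, div_le_div_iff₀ (by linarith) (by linarith), ← hβe] at sl
      have sl2 : β * (a - hz f x) ≤ y - x := by nlinarith
      rw [min_eq_left (by linarith)]
      apply mul_nonneg_of_nonpos_of_nonpos
      · linarith
      · nlinarith
    · rw [hxy, hya, hau]; simp
    · have h1 := h.hz_mono hy hx hxy
      rw [hya] at h1
      have w0 : 0 ≤ (u + 1) * hz f x - u := by nlinarith
      apply mul_nonneg _ w0
      rcases lt_or_ge x t with hxt | hxt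
      · have h2 := h.hz_mono hx ht hxt
        have sl := cvx.slope_mono_adjacent hy ht hxy hxt
        rw [hya, ← hu, div_le_div_iff₀ (by linarith) (by linarith)] at sl
        rw [min_eq_left (by linarith)]
        have : (hz f x - a) * (t - y) ≤ (u - a) * (x - y) := by nlinarith
        rw [← hβe] at this
        have : β * (hz f x - a) ≤ x - y := by nlinarith
        linarith
      · have h2 := h.hz_mono.monotoneOn ht hx hxt
        rw [min_eq_right h2]
        linarith
  have hW : Integrable (fun x => (u + 1) * hz f x - u) (ms f) :=
    (i1.const_mul _).sub (integrable_const _)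
  have eW : ∫ x, ((u + 1) * hz f x - u) ∂(ms f) = 1 := by
    rw [integral_sub (i1.const_mul _) (integrable_const _), integral_const_mul, e1, integral_const]
    simp
  have hm : u ≤ ∫ x, min (hz f x) u * ((u + 1) * hz f x - u) ∂(ms f) := by
    rw [h.hz_map (g := fun v => min v u * ((u + 1) * v - u)) (by fun_prop)]
    exact expM_min_ge hu0
  have iM : Integrable (fun x => min (hz f x) u * ((u + 1) * hz f x - u)) (ms f) := by
    apply Integrable.of_integral_ne_zero
    linarith
  have A1 : Integrable (fun x => (y - m - β * a) * ((u + 1) * hz f x - u)) (ms f) := hW.const_mul _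
  have A2 : Integrable (fun x => β * (min (hz f x) u * ((u + 1) * hz f x - u))) (ms f) :=
    iM.const_mul _
  have A3 : Integrable (fun x => (u + 1) * ((x - m) * hz f x)) (ms f) := k.const_mul _
  have A4 : Integrable (fun x => u * (x - m)) (ms f) := j1.const_mul _
  have := integral_mono_ae (A1.add A2) (A3.sub A4) key
  simp only [Pi.add_apply, Pi.sub_apply] at this
  rw [integral_add A1 A2, integral_sub A3 A4, integral_const_mul, integral_const_mul,
    integral_const_mul, integral_const_mul, eW, d1] at this
  have h5 : β * u ≤ β * ∫ x, min (hz f x) u * ((u + 1) * hz f x - u) ∂(ms f) :=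
    mul_le_mul_of_nonneg_left hm hβ0.le
  have h6 : (u + 1) * ∫ x, (x - m) * hz f x ∂(ms f) ≤ (u + 1) * σ :=
    mul_le_mul_of_nonneg_left kv (by linarith)
  nlinarith

theorem LC.tail {f : ℝ → ℝ} {m σ : ℝ} (h : LC f m σ) (t : ℝ) :
    tl f t ≤ Real.exp (1 - (t - m) / σ) := by
  have hσ := h.pos
  by_cases ht : t ∈ interior {x | 0 < f x}
  · have h1 := h.tail_J ht
    rw [← Real.exp_log (h.tl_pos ht).1]
    apply Real.exp_le_exp.2
    have : (t - m) / σ ≤ hz f t + 1 := by rw [div_le_iff₀ hσ]; exact h1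
    unfold hz at this
    linarith
  · rcases h.J_cases ht with h0 | ⟨h0, h1⟩
    · rw [h0]; positivity
    · rw [h0]
      apply Real.one_le_exp
      have : 0 ≤ ∫ x, (x - t) * f x := by
        apply integral_nonneg_of_ae
        filter_upwards [h1] with x hx
        rcases hx with hx | hx
        · simp [hx]
        · exact mul_nonneg (by linarith) (h.nn x)
      have e : (fun x => (x - t) * f x) = fun x => (x - m) * f x + (m - t) * f x := by
        ext x; ring
      rw [e, integral_add h.int1 (h.int.const_mul _), h.mean, integral_const_mul, h.one] at this
      have : (t - m) / σ ≤ 0 := div_nonpos_of_nonpos_of_nonneg (by linarith) hσ.le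
      linarith

theorem LC.tail_two {f : ℝ → ℝ} {m σ : ℝ} (h : LC f m σ) (T : ℝ) :
    (ms f).real {x | σ * T < |x - m|} ≤ 2 * Real.exp (1 - T) := by
  have hσ := h.pos
  have := h.ms_prob
  have hsub : {x | σ * T < |x - m|} ⊆ Ioi (m + σ * T) ∪ Iio (m - σ * T) := by
    intro x hx
    rcases lt_abs.1 (show σ * T < |x - m| from hx) with h1 | h1
    · left; show m + σ * T < x; linarith
    · right; show x < m - σ * T; linarith
  have h1 : (ms f).real (Ioi (m + σ * T)) ≤ Real.exp (1 - T) := by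
    rw [Measure.real, h.ms_set measurableSet_Ioi, ENNReal.toReal_ofReal (integral_nonneg h.nn)]
    have := h.tail (m + σ * T)
    rwa [show (m + σ * T - m) / σ = T by field_simp; ring] at this
  have h2 : (ms f).real (Iio (m - σ * T)) ≤ Real.exp (1 - T) := by
    rw [Measure.real, h.ms_set measurableSet_Iio, ENNReal.toReal_ofReal (integral_nonneg h.nn)]
    have := h.reflect.tail (-m + σ * T)
    rw [show (-m + σ * T - -m) / σ = T by field_simp; ring, tl, integral_comp_neg_Ioi,
      integral_Iic_eq_integral_Iio] at this
    rwa [show -(-m + σ * T) = m - σ * T by ring] at this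
  calc _ ≤ (ms f).real (Ioi (m + σ * T) ∪ Iio (m - σ * T)) := measureReal_mono hsub
    _ ≤ _ := measureReal_union_le _ _
    _ ≤ _ := by linarith


theorem LC.mode {f : ℝ → ℝ} {m σ : ℝ} (h : LC f m σ) :
    ∃ M0, (∀ x y, x ≤ y → y < M0 → f x ≤ f y) ∧ (∀ x y, M0 < x → x ≤ y → f y ≤ f x) := by
  obtain ⟨p, hp⟩ := h.exists_high
  have hp0 : 0 < f p := lt_of_lt_of_le (by have := h.pos; positivity) hp
  set A : Set ℝ := {x | ∃ y > x, f x < f y} with hA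
  have low : ∀ x ∈ A, ∀ x', x' ≤ x → f x' ≤ f x := by
    rintro x ⟨y, hy, hxy⟩ x' hx'
    have := h.quasi hx' (le_of_lt hy)
    rcases min_le_iff.1 this with h1 | h1
    · exact h1
    · linarith
  have low2 : ∀ x ∈ A, ∀ x', x' ≤ x → x' ∈ A := by
    rintro x hx x' hx'
    have h1 := low x hx x' hx'
    obtain ⟨y, hy, hxy⟩ := hx
    exact ⟨y, lt_of_le_of_lt hx' hy, lt_of_le_of_lt h1 hxy⟩
  have up : ∀ x, x ∉ A → ∀ y, x ≤ y → f y ≤ f x := by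
    intro x hx y hxy
    rcases hxy.eq_or_lt with rfl | hlt
    · exact le_rfl
    by_contra hc
    push Not at hc
    exact hx ⟨y, hlt, hc⟩
  have noInf : ∀ s : Set ℝ, MeasurableSet s → volume s = ⊤ → ¬ (∀ x ∈ s, f p ≤ f x) := by
    intro s hs hv hall
    have : IntegrableOn (fun _ => f p) s := by
      refine Integrable.mono' h.int.integrableOn aestronglyMeasurable_const ?_
      filter_upwards [ae_restrict_mem hs] with x hx
      rw [Real.norm_of_nonneg hp0.le]; exact hall x hx
    rw [integrableOn_const_iff] at this
    rcases this with h1 | h1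
    · simp at h1; linarith
    · rw [hv] at h1; exact lt_irrefl _ h1
  have ne : A.Nonempty := by
    by_contra hc
    rw [not_nonempty_iff_eq_empty] at hc
    apply noInf (Iic p) measurableSet_Iic (by simp)
    intro x hx
    exact up x (by rw [hc]; simp) p hx
  have bd : BddAbove A := by
    by_contra hc
    have all : ∀ x, x ∈ A := by
      intro x
      rw [not_bddAbove_iff] at hc
      obtain ⟨y, hy, hxy⟩ := hc x
      exact low2 y hy x hxy.le
    apply noInf (Ici p) measurableSet_Ici (by simp)
    intro x hx
    exact low x (all x) p hx
  refine ⟨sSup A, ?_, ?_⟩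
  · intro x y hxy hy
    obtain ⟨w, hw, hyw⟩ := exists_lt_of_lt_csSup ne hy
    exact low y (low2 w hw y hyw.le) x hxy
  · intro x y hx hxy
    exact up x (fun hxA => absurd (le_csSup bd hxA) (not_le.2 hx)) y hxy

theorem bdd_int {f g : ℝ → ℝ} (hf : Integrable f) (hg : Measurable g) (hb : ∀ x, |g x| ≤ 1) :
    Integrable (fun x => g x * f x) :=
  hf.bdd_mul hg.aestronglyMeasurable (c := 1) (Filter.Eventually.of_forall hb)

theorem bdd_ii {g : ℝ → ℝ} (hg : Measurable g) (hb : ∀ x, |g x| ≤ 1) (a b : ℝ) :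
    IntervalIntegrable g volume a b := by
  have : IntervalIntegrable (fun _ : ℝ => (1:ℝ)) volume a b := intervalIntegrable_const
  refine this.mono_fun hg.aestronglyMeasurable (Filter.Eventually.of_forall fun x => ?_)
  simpa using hb x

theorem piece {f g : ℝ → ℝ} {θ H : ℝ} (hf : Integrable f) (hg : Measurable g)
    (hb : ∀ x, |g x| ≤ 1) (g0 : ∀ x, 0 ≤ g x) (hp : Function.Periodic g θ) (hθ : 0 < θ)
    (hH : ∀ x, f x ≤ H) (a : ℝ) :
    ∫ x in a..(a + θ), g x * f x ≤ H * ∫ x in (0:ℝ)..θ, g x := by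
  have e := hp.intervalIntegral_add_eq a 0
  rw [zero_add] at e
  rw [← e, ← intervalIntegral.integral_const_mul]
  apply intervalIntegral.integral_mono_on (by linarith) (bdd_int hf hg hb).intervalIntegrable
    ((bdd_ii hg hb _ _).const_mul _)
  intro x _
  nlinarith [g0 x, hH x]

theorem shift_Ioi {G : ℝ → ℝ} (hG : Integrable G) (a θ : ℝ) :
    ∫ x in Ioi a, (G x - G (x + θ)) = ∫ x in a..(a + θ), G x := by
  have := (measurePreserving_add_right (volume : Measure ℝ) θ).setIntegral_preimage_emb
    (measurableEmbedding_addRight θ) G (Ioi (a + θ))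
  simp only [preimage_add_const_Ioi, add_sub_cancel_right] at this
  rw [integral_sub hG.integrableOn (hG.comp_add_right θ).integrableOn, this]
  have := intervalIntegral.integral_interval_add_Ioi (a := a) (b := a + θ) hG.integrableOn
    hG.integrableOn
  linarith

theorem shift_Iio {G : ℝ → ℝ} (hG : Integrable G) (a θ : ℝ) :
    ∫ x in Iio a, (G (x + θ) - G x) = ∫ x in a..(a + θ), G x := by
  have := (measurePreserving_add_right (volume : Measure ℝ) θ).setIntegral_preimage_emb
    (measurableEmbedding_addRight θ) G (Iio (a + θ))
  simp only [preimage_add_const_Iio, add_sub_cancel_right] at this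
  rw [integral_sub (hG.comp_add_right θ).integrableOn hG.integrableOn, this]
  rw [← integral_Iic_eq_integral_Iio, ← integral_Iic_eq_integral_Iio]
  exact intervalIntegral.integral_Iic_sub_Iic hG.integrableOn hG.integrableOn

theorem LC.shift {f ψ : ℝ → ℝ} {m σ H θ : ℝ} (h : LC f m σ) (hH : ∀ x, f x ≤ H)
    (hm : Measurable ψ) (hb : ∀ x, |ψ x| ≤ 1) (hp : Function.Periodic ψ θ) (hθ : 0 < θ) (z : ℝ) :
    |(∫ x, ψ x * f x) - ∫ x, ψ (x - z) * f x| ≤ 3 * (H * ∫ x in (0:ℝ)..θ, |ψ x|) := by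
  obtain ⟨M0, hM1, hM2⟩ := h.mode
  set w := θ * Int.fract (z / θ) with hw
  have hw0 : 0 ≤ w := mul_nonneg hθ.le (Int.fract_nonneg _)
  have hw1 : w ≤ θ := by
    have := (Int.fract_lt_one (z / θ)).le
    nlinarith
  have hzw : z = w + ⌊z / θ⌋ * θ := by
    rw [hw]
    have : z = θ * (z / θ) := by field_simp
    nlinarith [Int.fract_add_floor (z / θ)]
  have e1 : ∫ x, ψ (x - z) * f x = ∫ x, ψ x * f (x + w) := by
    have e2 : ∀ x, ψ (x - z) = ψ (x - w) := by
      intro x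
      have := hp.sub_int_mul_eq (x := x - w) ⌊z / θ⌋
      rw [← this]; congr 1; linarith
    simp only [e2]
    rw [← integral_sub_right_eq_self (fun x => ψ x * f (x + w)) w]
    simp
  have iG := bdd_int h.int (g := fun x => |ψ x|) (by fun_prop) (fun x => by simpa using hb x)
  have hpg : Function.Periodic (fun x => |ψ x|) θ := fun x => by simp only [hp x]
  have iw : Integrable (fun x => ψ x * f (x + w)) := bdd_int (h.int.comp_add_right w) hm hb
  rw [e1, ← integral_sub (bdd_int h.int hm hb) iw]
  set G := fun x => |ψ x| * f x with hG
  have hGs : ∀ x, G (x + θ) = |ψ x| * f (x + θ) := by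
    intro x; simp only [hG, hp x]
  set I := ∫ x in (0:ℝ)..θ, |ψ x| with hI
  have key : ∀ x, ‖ψ x * f x - ψ x * f (x + w)‖ ≤
      ((Iio (M0 - θ)).indicator (fun x => G (x + θ) - G x) x +
      (Ioc (M0 - θ) (M0 - θ + θ)).indicator (fun x => H * |ψ x|) x) +
      (Ioi M0).indicator (fun x => G x - G (x + θ)) x ∨ x = M0 - θ := by
    intro x
    by_cases hxe : x = M0 - θ
    · exact Or.inr hxe
    left
    have e : ‖ψ x * f x - ψ x * f (x + w)‖ = |ψ x| * |f x - f (x + w)| := by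
      rw [← mul_sub, Real.norm_eq_abs, abs_mul]
    rw [e]
    have a0 := abs_nonneg (ψ x)
    rcases lt_or_gt_of_ne hxe with hx | hx
    · rw [indicator_of_mem (show x ∈ Iio (M0 - θ) from hx),
        indicator_of_notMem (fun hc : x ∈ Ioc (M0 - θ) (M0 - θ + θ) => by linarith [hc.1]),
        indicator_of_notMem (fun hc : x ∈ Ioi M0 => by linarith [show M0 < x from hc])]
      rw [hGs, hG]
      have m1 := hM1 x (x + w) (by linarith) (by linarith)
      have m2 := hM1 (x + w) (x + θ) (by linarith) (by linarith)
      rw [abs_of_nonpos (show f x - f (x + w) ≤ 0 by linarith)]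
      simp only
      nlinarith
    · rcases le_or_gt x M0 with hx2 | hx2
      · rw [indicator_of_notMem (fun hc : x ∈ Iio (M0 - θ) => by linarith [show x < M0 - θ from hc]),
          indicator_of_mem (show x ∈ Ioc (M0 - θ) (M0 - θ + θ) from ⟨hx, by linarith⟩),
          indicator_of_notMem (fun hc : x ∈ Ioi M0 => by linarith [show M0 < x from hc])]
        have : |f x - f (x + w)| ≤ H := by
          rw [abs_le]; constructor <;> linarith [h.nn x, h.nn (x + w), hH x, hH (x + w)]
        nlinarith
      · rw [indicator_of_notMem (fun hc : x ∈ Iio (M0 - θ) => by linarith [show x < M0 - θ from hc]),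
          indicator_of_notMem (fun hc : x ∈ Ioc (M0 - θ) (M0 - θ + θ) => by linarith [hc.2]),
          indicator_of_mem (show x ∈ Ioi M0 from hx2)]
        rw [hGs, hG]
        have m1 := hM2 x (x + w) (by linarith) (by linarith)
        have m2 := hM2 (x + w) (x + θ) (by linarith) (by linarith)
        rw [abs_of_nonneg (show 0 ≤ f x - f (x + w) by linarith)]
        simp only
        nlinarith
  have key' : ∀ᵐ x, ‖ψ x * f x - ψ x * f (x + w)‖ ≤
      ((Iio (M0 - θ)).indicator (fun x => G (x + θ) - G x) x +
      (Ioc (M0 - θ) (M0 - θ + θ)).indicator (fun x => H * |ψ x|) x) +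
      (Ioi M0).indicator (fun x => G x - G (x + θ)) x := by
    have : ∀ᵐ x : ℝ, x ≠ M0 - θ := by
      rw [ae_iff]; simp
    filter_upwards [this] with x hx
    exact (key x).resolve_right hx
  have hle : M0 - θ ≤ M0 - θ + θ := by linarith
  have ii : IntervalIntegrable (fun x => H * |ψ x|) volume (M0 - θ) (M0 - θ + θ) :=
    (bdd_ii (g := fun x => |ψ x|) (by fun_prop) (fun x => by simpa using hb x) _ _).const_mul H
  have B1 : Integrable ((Iio (M0 - θ)).indicator (fun x => G (x + θ) - G x)) :=
    ((iG.comp_add_right θ).sub iG).indicator measurableSet_Iio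
  have B2 : Integrable ((Ioc (M0 - θ) (M0 - θ + θ)).indicator (fun x => H * |ψ x|)) :=
    (integrable_indicator_iff measurableSet_Ioc).2 ii.1
  have B3 : Integrable ((Ioi M0).indicator (fun x => G x - G (x + θ))) :=
    (iG.sub (iG.comp_add_right θ)).indicator measurableSet_Ioi
  have B12 : Integrable (fun x => (Iio (M0 - θ)).indicator (fun x => G (x + θ) - G x) x +
      (Ioc (M0 - θ) (M0 - θ + θ)).indicator (fun x => H * |ψ x|) x) := B1.add B2
  have := norm_integral_le_of_norm_le (B12.add B3) key'
  simp only [Pi.add_apply] at this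
  rw [integral_add B12 B3, integral_add B1 B2, integral_indicator measurableSet_Iio,
    integral_indicator measurableSet_Ioc, integral_indicator measurableSet_Ioi,
    shift_Iio iG, shift_Ioi iG, ← intervalIntegral.integral_of_le hle,
    intervalIntegral.integral_const_mul, hpg.intervalIntegral_add_eq (M0 - θ) 0, zero_add] at this
  have p1 := piece h.int (g := fun x => |ψ x|) (by fun_prop) (fun x => by simpa using hb x)
    (fun x => abs_nonneg _) hpg hθ hH (M0 - θ)
  have p2 := piece h.int (g := fun x => |ψ x|) (by fun_prop) (fun x => by simpa using hb x)
    (fun x => abs_nonneg _) hpg hθ hH M0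
  rw [Real.norm_eq_abs] at this
  linarith

theorem LC.low {f ψ : ℝ → ℝ} {m σ c θ a : ℝ} (h : LC f m σ) (hc : 0 < c)
    (hf : ∀ x ∈ Icc a (a + σ), c / σ ≤ f x)
    (hm : Measurable ψ) (hb : ∀ x, |ψ x| ≤ 1) (hp : Function.Periodic ψ θ) (hθ : 0 < θ)
    (hθσ : θ < σ) :
    ∫ x in (0:ℝ)..θ, |ψ x| ≤ 2 * θ / c * ∫ x, |ψ x| * f x := by
  have hσ := h.pos
  have hpg : Function.Periodic (fun x => |ψ x|) θ := fun x => by simp only [hp x]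
  have hbg : ∀ x, |(|ψ x|)| ≤ 1 := fun x => by simpa using hb x
  have iG := bdd_int h.int (g := fun x => |ψ x|) (by fun_prop) hbg
  set I := ∫ x in (0:ℝ)..θ, |ψ x| with hI
  have hI0 : 0 ≤ I := intervalIntegral.integral_nonneg hθ.le (fun x _ => abs_nonneg _)
  set n := ⌊σ / θ⌋ with hn
  have n1 : (n:ℝ) * θ ≤ σ := by
    have := Int.floor_le (σ / θ)
    rwa [le_div_iff₀ hθ] at this
  have one_le : 1 ≤ n := by
    rw [hn, Int.le_floor]
    rw [Int.cast_one, le_div_iff₀ hθ]; linarith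
  have n2 : σ < 2 * (n:ℝ) * θ := by
    have h1 := Int.lt_floor_add_one (σ / θ)
    rw [div_lt_iff₀ hθ] at h1
    have : (1:ℝ) ≤ n := by exact_mod_cast one_le
    nlinarith
  have hn0 : (0:ℝ) ≤ n := by exact_mod_cast (by linarith : (0:ℤ) ≤ n)
  have hle : a ≤ a + n • θ := by
    rw [zsmul_eq_mul]; nlinarith
  have e := hpg.intervalIntegral_add_zsmul_eq n a (fun s t => bdd_ii (by fun_prop) hbg s t)
  rw [hpg.intervalIntegral_add_eq a 0, zero_add, zsmul_eq_mul (a := ∫ x in (0:ℝ)..θ, |ψ x|)] at e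
  have h1 : (c / σ) * ∫ x in a..(a + n • θ), |ψ x| ≤ ∫ x in a..(a + n • θ), |ψ x| * f x := by
    rw [← intervalIntegral.integral_const_mul]
    apply intervalIntegral.integral_mono_on hle ((bdd_ii (by fun_prop) hbg _ _).const_mul _)
      iG.intervalIntegrable
    intro x hx
    rw [zsmul_eq_mul] at hx
    have := hf x ⟨hx.1, by linarith [hx.2]⟩
    nlinarith [abs_nonneg (ψ x)]
  have h2 : ∫ x in a..(a + n • θ), |ψ x| * f x ≤ ∫ x, |ψ x| * f x := by
    rw [intervalIntegral.integral_of_le hle]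
    exact setIntegral_le_integral iG
      (Filter.Eventually.of_forall fun x => mul_nonneg (abs_nonneg _) (h.nn x))
  rw [e] at h1
  have h3 : (c / σ) * (n * I) ≤ ∫ x, |ψ x| * f x := le_trans h1 h2
  have h4 : c * (n * I) ≤ σ * ∫ x, |ψ x| * f x := by
    have := mul_le_mul_of_nonneg_left h3 hσ.le
    have e : σ * (c / σ * (n * I)) = c * (n * I) := by field_simp
    linarith
  have hnp : (0:ℝ) < n := by exact_mod_cast (by linarith : (0:ℤ) < n)
  have hE : 0 ≤ ∫ x, |ψ x| * f x := integral_nonneg fun x => mul_nonneg (abs_nonneg _) (h.nn x)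
  have h5 : n * (c * I) ≤ n * (2 * θ * ∫ x, |ψ x| * f x) := by nlinarith
  have h6 := le_of_mul_le_mul_left h5 hnp
  rw [div_mul_eq_mul_div, le_div_iff₀ hc]
  linarith


theorem LC.mk_of {f : ℝ → ℝ} {μm σ : ℝ} (nn : ∀ x, 0 ≤ f x) (conv : Convex ℝ {x | 0 < f x})
    (conc : ConcaveOn ℝ {x | 0 < f x} (fun x => Real.log (f x)))
    (hP : IsProbabilityMeasure (ms f)) (h1 : (∫ x, x ∂(ms f)) = μm)
    (h2 : (∫ x, (x - μm)^2 ∂(ms f)) = σ^2) (hσ : 0 < σ) : LC f μm σ := by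
  have am : AEMeasurable f := (lc_aem nn conv conc).2.2
  have am' : AEMeasurable (fun x => ENNReal.ofReal (f x)) := am.ennreal_ofReal
  have I : ∀ g : ℝ → ℝ, ∫ x, g x ∂(ms f) = ∫ x, g x * f x := by
    intro g
    rw [ms, integral_withDensity_eq_integral_toReal_smul₀ am' (by simp)]
    congr 1; ext x
    rw [ENNReal.toReal_ofReal (nn x), smul_eq_mul, mul_comm]
  have J : ∀ g : ℝ → ℝ, Integrable g (ms f) ↔ Integrable (fun x => g x * f x) := by
    intro g
    rw [ms, integrable_withDensity_iff_integrable_smul₀' am' (by simp)]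
    have : (fun x => (ENNReal.ofReal (f x)).toReal • g x) = fun x => g x * f x := by
      ext x
      rw [ENNReal.toReal_ofReal (nn x), smul_eq_mul, mul_comm]
    rw [this]
  have i2 : Integrable (fun x => (x - μm)^2) (ms f) := by
    apply Integrable.of_integral_ne_zero; rw [h2]; positivity
  have i1 : Integrable (fun x => x - μm) (ms f) := by
    have hm : AEStronglyMeasurable (fun x : ℝ => x - μm) (ms f) :=
      (measurable_id.sub_const μm).aestronglyMeasurable
    exact ((memLp_two_iff_integrable_sq hm).2 i2).integrable (by norm_num)
  have i0 : Integrable (fun x : ℝ => x) (ms f) := by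
    have := i1.add (integrable_const μm)
    refine this.congr (Filter.Eventually.of_forall fun x => ?_)
    simp
  refine ⟨nn, conv, conc, ?_, ?_, (J _).1 i1, ?_, (J _).1 i2, ?_, hσ⟩
  · have := (J (fun _ => 1)).1 (integrable_const 1)
    simpa using this
  · have := I (fun _ => 1)
    simp at this
    exact this.symm
  · rw [← I (fun x => x - μm), integral_sub i0 (integrable_const _), h1]; simp
  · rw [← I (fun x => (x - μm)^2), h2]

theorem LC.cmp {f : ℝ → ℝ} {m σ T d : ℝ} (h : LC f m σ) (hT : 2 * Real.exp (1 - T) ≤ 2 * d)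
    {u v : ℝ → ℝ} (hu : Measurable u) (hv : Measurable v) (bu : ∀ x, |u x| ≤ 1)
    (bv : ∀ x, |v x| ≤ 1) (huv : ∀ x, |x - m| ≤ σ * T → |u x - v x| ≤ 2 * d) (hd : 0 ≤ d) :
    |(∫ x, u x ∂(ms f)) - ∫ x, v x ∂(ms f)| ≤ 6 * d := by
  have := h.ms_prob
  have iu : Integrable u (ms f) := Integrable.of_bound hu.aestronglyMeasurable 1
    (Filter.Eventually.of_forall bu)
  have iv : Integrable v (ms f) := Integrable.of_bound hv.aestronglyMeasurable 1
    (Filter.Eventually.of_forall bv)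
  rw [← integral_sub iu iv]
  set S : Set ℝ := {x | σ * T < |x - m|} with hSd
  have hS : MeasurableSet S :=
    measurableSet_lt measurable_const (by fun_prop)
  have iS : Integrable (S.indicator (fun _ => (2:ℝ))) (ms f) :=
    (integrable_const _).indicator hS
  have iR : Integrable (fun x => 2 * d + S.indicator (fun _ => (2:ℝ)) x) (ms f) :=
    (integrable_const (2 * d)).add iS
  have key : ∀ x, |u x - v x| ≤ 2 * d + S.indicator (fun _ => (2:ℝ)) x := by
    intro x
    by_cases hx : σ * T < |x - m|
    · have hx' : x ∈ S := hx
      rw [indicator_of_mem hx']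
      have := abs_sub (u x) (v x)
      linarith [bu x, bv x]
    · have hx' : x ∉ S := hx
      rw [indicator_of_notMem hx']
      linarith [huv x (not_lt.1 hx)]
  calc |∫ x, (u x - v x) ∂(ms f)| ≤ ∫ x, |u x - v x| ∂(ms f) := abs_integral_le_integral_abs
    _ ≤ ∫ x, (2 * d + S.indicator (fun _ => (2:ℝ)) x) ∂(ms f) :=
        integral_mono (iu.sub iv).abs iR key
    _ = 2 * d + 2 * (ms f).real S := by
        rw [integral_add (integrable_const _) iS, integral_indicator_const _ hS]
        simp [mul_comm]
    _ ≤ 6 * d := by linarith [h.tail_two T]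

theorem final_one {K c : ℝ} (hK : 0 < K) (hc : 0 < c)
    {φ f : ℝ → ℝ} {M δ θ m σ z a : ℝ} (h : LC f m σ) (hH : ∀ x, f x ≤ K / σ)
    (hf : ∀ x ∈ Icc a (a + σ), c / σ ≤ f x) (hθ : 0 < θ) (hδ : 0 < δ) (hδ1 : δ < 1)
    (hφ : ∀ x, φ x ∈ Icc (-1:ℝ) 1) (hm : Measurable φ)
    (hq : ∃ φt : ℝ → ℝ, Function.Periodic φt θ ∧ ∀ x, |x| ≤ M → |φ x - φt x| < δ)
    (hθσ : θ < σ) (hz : |z| < M - σ * (1 + Real.log (1/δ)) - |m|) :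
    |(∫ x, φ x ∂(ms f)) - ∫ x, φ (x - z) ∂(ms f)| ≤
      (12 + 36 * (K / c)) * (δ + (θ/σ) * ∫ x, |φ x| ∂(ms f)) := by
  obtain ⟨φt, hp, hq⟩ := hq
  have hσ := h.pos
  have bφ : ∀ x, |φ x| ≤ 1 := fun x => abs_le.2 (hφ x)
  have hlog : 0 ≤ Real.log (1/δ) := Real.log_nonneg (by rw [le_div_iff₀ hδ]; linarith)
  have hM : σ < M := by
    have := abs_nonneg z
    have := abs_nonneg m
    nlinarith [mul_nonneg hσ.le hlog]
  set ψ : ℝ → ℝ := fun x => φ (θ * Int.fract (x / θ)) with hψ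
  have mψ : Measurable ψ := hm.comp (by fun_prop)
  have bψ : ∀ x, |ψ x| ≤ 1 := fun x => bφ _
  have pψ : Function.Periodic ψ θ := by
    intro x
    simp only [hψ]
    rw [add_div, div_self hθ.ne', Int.fract_add_one]
  have cl : ∀ x, |x| ≤ M → |φ x - ψ x| ≤ 2 * δ := by
    intro x hx
    have e : φt (θ * Int.fract (x / θ)) = φt x := by
      have : θ * Int.fract (x / θ) = x - (⌊x / θ⌋ : ℤ) * θ := by
        rw [Int.fract, mul_sub, mul_div_cancel₀ _ hθ.ne']; ring
      rw [this]; exact hp.sub_int_mul_eq _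
    have h1 := hq x hx
    have f0 := Int.fract_nonneg (x / θ)
    have f1 := Int.fract_lt_one (x / θ)
    have h2 := hq (θ * Int.fract (x / θ)) (by
      rw [abs_of_nonneg (by positivity)]; nlinarith)
    rw [e] at h2
    have h2' : |ψ x - φt x| < δ := h2
    rw [abs_lt] at h1 h2'
    rw [abs_le]
    constructor <;> linarith [h1.1, h1.2, h2'.1, h2'.2]
  set T := 1 + Real.log (1/δ) with hTd
  have hT : 2 * Real.exp (1 - T) ≤ 2 * δ := by
    rw [hTd, show 1 - (1 + Real.log (1/δ)) = Real.log δ by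
      rw [one_div, Real.log_inv]; ring, Real.exp_log hδ]
  have tri : ∀ x, |x - m| ≤ σ * T → |x| ≤ M - |z| := by
    intro x hx
    have : |x| ≤ |x - m| + |m| := by
      have := abs_add_le (x - m) m
      simpa using this
    linarith
  have c0 := h.cmp hT hm mψ bφ bψ (fun x hx => cl x (by
    linarith [tri x hx, abs_nonneg z])) hδ.le
  have c1 := h.cmp (u := fun x => φ (x - z)) (v := fun x => ψ (x - z)) hT
    (hm.comp (by fun_prop)) (mψ.comp (by fun_prop))
    (fun x => bφ _) (fun x => bψ _) (fun x hx => cl _ (by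
    linarith [tri x hx, abs_sub x z])) hδ.le
  have c2 := h.cmp (u := fun x => |φ x|) (v := fun x => |ψ x|) hT
    (by fun_prop) (by fun_prop)
    (fun x => by rw [abs_abs]; exact bφ _) (fun x => by rw [abs_abs]; exact bψ _) (fun x hx =>
      (abs_abs_sub_abs_le_abs_sub _ _).trans (cl _ (by
    linarith [tri x hx, abs_nonneg z]))) hδ.le
  have s := h.shift hH mψ bψ pψ hθ z
  have l := h.low hc hf mψ bψ pψ hθ hθσ
  rw [← h.ms_int, ← h.ms_int (fun x => ψ (x - z))] at s
  rw [← h.ms_int (fun x => |ψ x|)] at l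
  set E := ∫ x, |φ x| ∂(ms f) with hE
  set E' := ∫ x, |ψ x| ∂(ms f) with hE'
  have hEn : 0 ≤ E := integral_nonneg fun x => abs_nonneg _
  have hE1 : E' ≤ E + 6 * δ := by linarith [(abs_le.1 c2).1]
  have s2 : 3 * (K / σ * ∫ x in (0:ℝ)..θ, |ψ x|) ≤ 6 * (K / c) * ((θ / σ) * (E + 6 * δ)) := by
    calc 3 * (K / σ * ∫ x in (0:ℝ)..θ, |ψ x|) ≤ 3 * (K / σ * (2 * θ / c * (E + 6 * δ))) := by
          gcongr
          exact l.trans (by gcongr)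
      _ = _ := by field_simp; ring
  have r : θ / σ < 1 := (div_lt_one hσ).2 hθσ
  have r0 : 0 < θ / σ := by positivity
  have k0 : 0 < K / c := by positivity
  have t1 : (θ / σ) * (E + 6 * δ) ≤ (θ / σ) * E + 6 * δ := by nlinarith
  have t2 : 6 * (K / c) * ((θ / σ) * (E + 6 * δ)) ≤ 6 * (K / c) * ((θ / σ) * E + 6 * δ) := by
    gcongr
  have t3 : 0 ≤ (K / c) * ((θ / σ) * E) := by positivity
  have t4 : 0 ≤ (θ / σ) * E := by positivity
  have fin : |(∫ x, φ x ∂(ms f)) - ∫ x, φ (x - z) ∂(ms f)| ≤ 12 * δ +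
      6 * (K / c) * ((θ / σ) * E + 6 * δ) := by
    rw [abs_le] at *
    constructor <;> linarith [c0.1, c0.2, c1.1, c1.2, s.1, s.2]
  refine fin.trans ?_
  nlinarith


/-- Shift stability of expectations of quasiperiodic functions under logconcave
distributions. -/
theorem stmt_16 :
    ∃ C > (0:ℝ), ∀ (φ f : ℝ → ℝ) (M δ θ μm σ z : ℝ) (μ : Measure ℝ),
      0 < θ → 0 < δ → δ < 1 →
      (∀ x, φ x ∈ Icc (-1:ℝ) 1) → Measurable φ →
      (∃ φt : ℝ → ℝ, Function.Periodic φt θ ∧ ∀ x, |x| ≤ M → |φ x - φt x| < δ) →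
      (∀ x, 0 ≤ f x) →
      Convex ℝ {x | 0 < f x} →
      ConcaveOn ℝ {x | 0 < f x} (fun x => Real.log (f x)) →
      μ = volume.withDensity (fun x => ENNReal.ofReal (f x)) →
      IsProbabilityMeasure μ →
      (∫ x, x ∂μ) = μm →
      (∫ x, (x - μm)^2 ∂μ) = σ^2 →
      θ < σ →
      |z| < M - σ * (1 + Real.log (1/δ)) - |μm| →
      |(∫ x, φ x ∂μ) - ∫ x, φ (x - z) ∂μ| ≤ C * (δ + (θ/σ) * ∫ x, |φ x| ∂μ) := by
  obtain ⟨K, hK, up⟩ := upper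
  obtain ⟨c, hc, lo⟩ := lower
  refine ⟨12 + 36 * (K / c), by positivity, ?_⟩
  intro φ f M δ θ μm σ z μ hθ hδ hδ1 hφ hm hq nn conv conc hμ hP h1 h2 hθσ hz
  subst hμ
  have h : LC f μm σ := LC.mk_of nn conv conc hP h1 h2 (hθ.trans hθσ)
  obtain ⟨a, ha⟩ := lo f μm σ h
  exact final_one hK hc h (up f μm σ h) ha hθ hδ hδ1 hφ hm hq hθσ hz
end
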